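/- arXiv:1408.6322 — 11 statements merged into one kernel-verified Lean document; each statement's English description precedes it below -/
import Mathlib

section
/- Let A ⊆ ℝⁿ be an arbitrary subset, let f : A → ℝ and V : A → ℝⁿ, and suppose there exists M ≥ 0 such that for all x, y ∈ A: |f(x)| ≤ M, ‖V(x)‖ ≤ M, ‖V(y) − V(x)‖ ≤ M‖y − x‖, and |f(x) + ⟨V(x), y − x⟩ − f(y)| ≤ M‖y − x‖². Then there exists a function f̃ : ℝⁿ → ℝ which is continuously differentiable with Lipschitz gradient, such that f̃(x) = f(x) and ∇f̃(x) = V(x) for every x ∈ A. (Whitney's extension theorem for C^{1,1}.) -/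
open scoped InnerProductSpace

section aux
variable {E : Type*} [NormedAddCommGroup E] [InnerProductSpace ℝ E]

lemma wh_small {K : ℝ} (hK : 0 < K) (d : E) (c : ℝ) (h : ∀ w : E, ⟪d, w⟫_ℝ ≤ K * ‖w‖ ^ 2 + c) :
    ‖d‖ ^ 2 ≤ 4 * K * c := by
  have h1 := h ((1 / (2 * K)) • d)
  rw [inner_smul_right, real_inner_self_eq_norm_sq, norm_smul, Real.norm_eq_abs,
    abs_of_pos (by positivity)] at h1
  field_simp at h1
  nlinarith

lemma wh_lip {K : ℝ} (hK : 0 < K) (F : E → ℝ) (s : E → E)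
    (h0 : ∀ x y, F x + ⟪s x, y - x⟫_ℝ ≤ F y)
    (h1 : ∀ x y, F y ≤ F x + ⟪s x, y - x⟫_ℝ + K * ‖y - x‖ ^ 2) (x y : E) :
    ‖s x - s y‖ ≤ 2 * K * ‖x - y‖ := by
  have := wh_small hK (s x - s y) (K * ‖x - y‖ ^ 2) (fun w => by
    have a := h0 x (y + w)
    have b := h1 y (y + w)
    have c := h1 x y
    rw [add_sub_cancel_left] at b
    rw [show y + w - x = (y - x) + w by abel, inner_add_right] at a
    rw [inner_sub_left, norm_sub_rev x y]
    linarith)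
  apply le_of_sq_le_sq _ (by positivity)
  nlinarith

lemma wh_grad [CompleteSpace E] {K : ℝ} (F : E → ℝ) (s : E → E)
    (h0 : ∀ x y, F x + ⟪s x, y - x⟫_ℝ ≤ F y)
    (h1 : ∀ x y, F y ≤ F x + ⟪s x, y - x⟫_ℝ + K * ‖y - x‖ ^ 2) (x : E) :
    HasGradientAt F (s x) x := by
  rw [hasGradientAt_iff_isLittleO]
  have : (fun y => F y - F x - ⟪s x, y - x⟫_ℝ) =O[nhds x] (fun y => ‖y - x‖ ^ 2) := by
    apply Asymptotics.IsBigO.of_bound K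
    filter_upwards with y
    have a := h0 x y
    have b := h1 x y
    rw [Real.norm_eq_abs, Real.norm_eq_abs, abs_of_nonneg (by linarith),
      abs_of_nonneg (by positivity)]
    linarith
  refine this.trans_isLittleO ?_
  exact Asymptotics.isLittleO_pow_sub_sub x one_lt_two

lemma wh_max [ProperSpace E] (A : Set E) (z : E) (hz : z ∈ A) (p : E → E → ℝ)
    (hp : Continuous (p z)) (a0 : ℝ) (s0 : E)
    (h0 : ∀ y ∈ A, ∀ w, a0 + ⟪s0, w⟫_ℝ ≤ p y w) (x : E) :
    ∃ a s, (∀ y ∈ A, ∀ w, a + ⟪s, w⟫_ℝ ≤ p y w) ∧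
      ∀ b t, (∀ y ∈ A, ∀ w, b + ⟪t, w⟫_ℝ ≤ p y w) → b + ⟪t, x⟫_ℝ ≤ a + ⟪s, x⟫_ℝ := by
  set T : Set (ℝ × E) := {q | (∀ y ∈ A, ∀ w, q.1 + ⟪q.2, w⟫_ℝ ≤ p y w) ∧
    a0 + ⟪s0, x⟫_ℝ ≤ q.1 + ⟪q.2, x⟫_ℝ} with hT
  have hcl : IsClosed T := by
    have : T = (⋂ y ∈ A, ⋂ w, {q : ℝ × E | q.1 + ⟪q.2, w⟫_ℝ ≤ p y w}) ∩
      {q : ℝ × E | a0 + ⟪s0, x⟫_ℝ ≤ q.1 + ⟪q.2, x⟫_ℝ} := by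
      ext q; simp [hT]
    rw [this]
    refine IsClosed.inter (isClosed_biInter fun y _ => isClosed_iInter fun w => ?_) ?_
    · exact isClosed_le (by fun_prop) (by fun_prop)
    · exact isClosed_le (by fun_prop) (by fun_prop)
  have hbd : Bornology.IsBounded T := by
    obtain ⟨C, hC⟩ := (isCompact_closedBall x (1:ℝ)).exists_bound_of_continuousOn hp.continuousOn
    set c := a0 + ⟪s0, x⟫_ℝ with hc
    have hS : ∀ q ∈ T, ‖q.2‖ ≤ C + |c| := by
      intro q hq
      have hx := (norm_nonneg _).trans (hC x (by simp))
      by_cases hq0 : q.2 = 0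
      · rw [hq0, norm_zero]; positivity
      · have hn : 0 < ‖q.2‖ := norm_pos_iff.2 hq0
        have a := hq.1 z hz (x + ‖q.2‖⁻¹ • q.2)
        have b := hC (x + ‖q.2‖⁻¹ • q.2) (by
          simp [norm_smul, hn.ne'])
        rw [inner_add_right, inner_smul_right, real_inner_self_eq_norm_sq] at a
        have e : ‖q.2‖⁻¹ * ‖q.2‖ ^ 2 = ‖q.2‖ := by field_simp
        rw [e] at a
        have := hq.2
        have := (abs_le.1 b).2
        have := neg_abs_le c
        linarith
    rw [isBounded_iff_forall_norm_le]
    refine ⟨(C + |c|) * (1 + ‖x‖) + (C + |c|), fun q hq => ?_⟩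
    have hs := hS q hq
    have hx := hC x (by simp)
    have hC0 := (norm_nonneg _).trans hx
    have i := abs_le.1 (abs_real_inner_le_norm q.2 x)
    have j : ‖q.2‖ * ‖x‖ ≤ (C + |c|) * ‖x‖ := by gcongr
    have k := hq.1 z hz x
    have l := hq.2
    have m := (abs_le.1 hx).2
    have n := neg_abs_le c
    have o := abs_nonneg c
    have r := mul_nonneg (add_nonneg hC0 o) (norm_nonneg x)
    rw [Prod.norm_def]
    apply max_le
    · rw [Real.norm_eq_abs, abs_le]
      constructor <;> linarith
    · linarith
  have hcomp := Metric.isCompact_of_isClosed_isBounded hcl hbd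
  obtain ⟨q, hq, hmax⟩ := hcomp.exists_isMaxOn (f := fun q : ℝ × E => q.1 + ⟪q.2, x⟫_ℝ)
    ⟨(a0, s0), h0, le_rfl⟩ (by fun_prop)
  refine ⟨q.1, q.2, hq.1, fun b t hb => ?_⟩
  by_cases h : a0 + ⟪s0, x⟫_ℝ ≤ b + ⟪t, x⟫_ℝ
  · exact hmax (show (b, t) ∈ T from ⟨hb, h⟩)
  · exact (not_le.1 h).le.trans hq.2

lemma wh_main [CompleteSpace E] [ProperSpace E] (A : Set E) (hA : A.Nonempty) (p : E → E → ℝ)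
    (K : ℝ) (hK : 0 < K)
    (hp : ∀ y, Continuous (p y)) (h : E → ℝ) (H : E → E)
    (hpar : ∀ y x v, p y (x + v) + p y (x - v) = 2 * p y x + K * ‖v‖ ^ 2)
    (hpy : ∀ y, p y y = h y)
    (hle : ∀ z ∈ A, ∀ y ∈ A, ∀ w, h z + ⟪H z, w - z⟫_ℝ ≤ p y w) :
    ∃ (F : E → ℝ) (s : E → E), (∀ x, HasGradientAt F (s x) x) ∧
      (∀ x y, ‖s x - s y‖ ≤ 2 * K * ‖x - y‖) ∧ ∀ x ∈ A, F x = h x ∧ s x = H x := by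
  obtain ⟨z0, hz0⟩ := hA
  have hle' : ∀ z ∈ A, ∀ y ∈ A, ∀ w, (h z - ⟪H z, z⟫_ℝ) + ⟪H z, w⟫_ℝ ≤ p y w := by
    intro z hz y hy w
    have := hle z hz y hy w
    rw [inner_sub_right] at this
    linarith
  choose a s hs hmax using fun x => wh_max A z0 hz0 p (hp z0) _ _ (hle' z0 hz0) x
  set F : E → ℝ := fun x => a x + ⟪s x, x⟫_ℝ with hF
  have h0 : ∀ x y, F x + ⟪s x, y - x⟫_ℝ ≤ F y := by
    intro x y
    have := hmax y (a x) (s x) (hs x)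
    simp only [hF, inner_sub_right]
    linarith
  have h1 : ∀ x y, F y ≤ F x + ⟪s x, y - x⟫_ℝ + K * ‖y - x‖ ^ 2 := by
    intro x y
    obtain ⟨v, rfl⟩ : ∃ v, y = x + v := ⟨y - x, by abel⟩
    have e := hmax x ((a (x + v) + ⟪s (x + v), v⟫_ℝ + a (x - v) - ⟪s (x - v), v⟫_ℝ
      - K * ‖v‖ ^ 2) / 2) ((1 / 2 : ℝ) • (s (x + v) + s (x - v))) (by
        intro y hy w
        have i := hs (x + v) y hy (w + v)
        have j := hs (x - v) y hy (w - v)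
        have k := hpar y w v
        rw [inner_add_right] at i
        rw [inner_sub_right] at j
        rw [real_inner_smul_left, inner_add_left]
        linarith)
    have g := h0 x (x - v)
    simp only [hF, real_inner_smul_left, inner_add_left, inner_add_right, inner_sub_right,
      add_sub_cancel_left] at e g ⊢
    linarith
  have hFA : ∀ x ∈ A, F x = h x := by
    intro x hx
    apply le_antisymm
    · have := hs x x hx x
      rwa [hpy] at this
    · have := hmax x _ _ (hle' x hx)
      simp only [hF]; linarith
  refine ⟨F, s, wh_grad F s h0 h1, wh_lip hK F s h0 h1, fun x hx => ⟨hFA x hx, ?_⟩⟩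
  have := wh_small hK (H x - s x) 0 (fun w => by
    have i := hmax (x + w) _ _ (hle' x hx)
    have j := h1 x (x + w)
    have k := hFA x hx
    rw [add_sub_cancel_left] at j
    rw [inner_add_right] at i
    rw [inner_sub_left]
    change _ ≤ F (x + w) at i
    linarith)
  have h2 : ‖H x - s x‖ = 0 := by
    have := norm_nonneg (H x - s x)
    nlinarith
  exact (sub_eq_zero.1 (norm_eq_zero.1 h2)).symm

end aux

/-- **Whitney's extension theorem for `C^{1,1}`**: if `f : A → ℝ` and `V : A → ℝⁿ` satisfy
uniform zeroth/first order bounds, a Lipschitz-type bound on `V` and a first-order Taylor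
estimate, then there is a `C¹` function on all of `ℝⁿ` with Lipschitz gradient extending `f`
whose gradient extends `V`. -/
theorem whitney_extension_C11 (n : ℕ) (A : Set (EuclideanSpace ℝ (Fin n)))
    (f : EuclideanSpace ℝ (Fin n) → ℝ)
    (V : EuclideanSpace ℝ (Fin n) → EuclideanSpace ℝ (Fin n))
    (M : ℝ) (hM : 0 ≤ M)
    (hfbd : ∀ x ∈ A, |f x| ≤ M)
    (hVbd : ∀ x ∈ A, ‖V x‖ ≤ M)
    (hVlip : ∀ x ∈ A, ∀ y ∈ A, ‖V y - V x‖ ≤ M * ‖y - x‖)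
    (htaylor : ∀ x ∈ A, ∀ y ∈ A, |f x + ⟪V x, y - x⟫_ℝ - f y| ≤ M * ‖y - x‖ ^ 2) :
    ∃ (g : EuclideanSpace ℝ (Fin n) → ℝ) (K : NNReal),
      ContDiff ℝ 1 g ∧ LipschitzWith K (gradient g) ∧
        ∀ x ∈ A, g x = f x ∧ gradient g x = V x := by
  rcases A.eq_empty_or_nonempty with rfl | hA
  · refine ⟨fun _ => 0, 0, contDiff_const, ?_, by simp⟩
    have : gradient (fun _ : EuclideanSpace ℝ (Fin n) => (0:ℝ)) = fun _ => 0 := by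
      ext1 x; exact gradient_fun_const x 0
    rw [this]; exact LipschitzWith.const 0
  set L : ℝ := 7 * M + 1 with hL
  have hL0 : 0 < L := by positivity
  obtain ⟨F, s, hgrad, hlip, hFA⟩ := wh_main A hA
    (fun y x => f y + ⟪V y, x - y⟫_ℝ + L / 2 * ‖x - y‖ ^ 2 + L / 2 * ‖x‖ ^ 2) (2 * L)
    (by positivity) (fun y => by fun_prop) (fun x => f x + L / 2 * ‖x‖ ^ 2)
    (fun x => V x + L • x)
    (by
      intro y x v
      have e1 : x + v - y = (x - y) + v := by abel
      have e2 : x - v - y = (x - y) - v := by abel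
      simp only [e1, e2, inner_add_right, inner_sub_right _ (x - y) v]
      have h1 := parallelogram_law_with_norm ℝ (x - y) v
      have h2 := parallelogram_law_with_norm ℝ x v
      linear_combination L / 2 * h1 + L / 2 * h2)
    (by intro y; simp)
    (by
      intro z hz y hy w
      have t := (abs_le.1 (htaylor y hy z hz)).1
      have v := hVlip z hz y hy
      have c := (abs_le.1 (abs_real_inner_le_norm (V y - V z) (w - z))).1
      have tri : ‖z - y‖ ≤ ‖w - y‖ + ‖w - z‖ := by
        have : z - y = (w - y) - (w - z) := by abel
        rw [this]; exact norm_sub_le _ _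
      have e : ⟪V y, w - y⟫_ℝ - ⟪V z, w - z⟫_ℝ = ⟪V y, z - y⟫_ℝ + ⟪V y - V z, w - z⟫_ℝ := by
        simp only [inner_sub_left, inner_sub_right]; ring
      have q : ‖w‖ ^ 2 = ‖z‖ ^ 2 + 2 * ⟪z, w - z⟫_ℝ + ‖w - z‖ ^ 2 := by
        rw [← norm_add_sq_real, add_sub_cancel]
      rw [norm_sub_rev y z] at v
      simp only [inner_add_left, real_inner_smul_left]
      set α := ‖w - y‖
      set β := ‖w - z‖
      have ha : 0 ≤ α := norm_nonneg _
      have hb : 0 ≤ β := norm_nonneg _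
      have v2 : ‖V y - V z‖ * β ≤ M * (α + β) * β := by
        have : ‖V y - V z‖ ≤ M * (α + β) := v.trans (by gcongr)
        gcongr
      have t2 : M * ‖z - y‖ ^ 2 ≤ M * (α + β) ^ 2 := by gcongr
      have fin : M * (α + β) ^ 2 + M * (α + β) * β ≤ L / 2 * α ^ 2 + L / 2 * β ^ 2 := by
        have i : (α + β) ^ 2 + (α + β) * β ≤ 7 / 2 * (α ^ 2 + β ^ 2) := by
          nlinarith [sq_nonneg (α - β)]
        have := mul_le_mul_of_nonneg_left i hM
        rw [hL]
        nlinarith [sq_nonneg α, sq_nonneg β]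
      rw [q]
      linarith)
  have hg : ∀ x, HasGradientAt (fun x => F x - L / 2 * ‖x‖ ^ 2) (s x - L • x) x := by
    intro x
    have h1 := (hgrad x).hasFDerivAt
    have h2 := (hasStrictFDerivAt_norm_sq x).hasFDerivAt.const_mul (L / 2)
    rw [hasGradientAt_iff_hasFDerivAt]
    refine (h1.sub h2).congr_fderiv ?_
    apply ContinuousLinearMap.ext
    intro w
    simp [two_smul]
    ring
  have hgr : gradient (fun x => F x - L / 2 * ‖x‖ ^ 2) = fun x => s x - L • x :=
    funext fun x => (hg x).gradient
  have hlip' : LipschitzWith (Real.toNNReal (5 * L)) (fun x => s x - L • x) := by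
    apply LipschitzWith.of_dist_le_mul
    intro x y
    rw [dist_eq_norm, dist_eq_norm, Real.coe_toNNReal _ (by positivity)]
    have e : s x - L • x - (s y - L • y) = (s x - s y) - L • (x - y) := by
      rw [smul_sub]; abel
    rw [e]
    refine (norm_sub_le _ _).trans ?_
    rw [norm_smul, Real.norm_eq_abs, abs_of_pos hL0]
    have := hlip x y
    linarith
  refine ⟨fun x => F x - L / 2 * ‖x‖ ^ 2, Real.toNNReal (5 * L), ?_, ?_, ?_⟩
  · rw [contDiff_one_iff_fderiv]
    refine ⟨fun x => (hg x).hasFDerivAt.differentiableAt, ?_⟩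
    have : fderiv ℝ (fun x => F x - L / 2 * ‖x‖ ^ 2) =
        fun x => InnerProductSpace.toDual ℝ _ (s x - L • x) :=
      funext fun x => (hg x).hasFDerivAt.fderiv
    rw [this]
    exact (InnerProductSpace.toDual ℝ _).continuous.comp hlip'.continuous
  · rw [hgr]; exact hlip'
  · intro x hx
    rw [hgr]
    obtain ⟨h1, h2⟩ := hFA x hx
    refine ⟨?_, ?_⟩
    · simp only [h1]; ring
    · simp only [h2]; abel
end

section
/- Let U ⊆ ℝⁿ be an open set and let f : U → ℝ be a C¹ function with locally Lipschitz gradient (a C^{1,1}-function). Assume x₀ ∈ U satisfies ∇f(x₀) ≠ 0. Then there exist an open set V ⊆ U containing x₀, an open set Ω₀ ⊆ ℝ^{n−1}, real numbers a < b, and a bijection G : Ω₀ × (a,b) → V such that both G and G⁻¹ are C¹ with locally Lipschitz derivatives, and f(G(y,t)) = t for all (y,t) ∈ Ω₀ × (a,b). (C^{1,1} straightening of a level set.) -/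
/-- A function is of class `C^{1,1}` on a set `U` if it is `C¹` on `U` and its derivative
is locally Lipschitz on `U`. -/
def IsC11On {E F : Type*} [NormedAddCommGroup E] [NormedSpace ℝ E]
    [NormedAddCommGroup F] [NormedSpace ℝ F] (f : E → F) (U : Set E) : Prop :=
  ContDiffOn ℝ 1 f U ∧
    ∀ x ∈ U, ∃ ε > 0, Metric.ball x ε ⊆ U ∧
      ∃ K : NNReal, LipschitzOnWith K (fderiv ℝ f) (Metric.ball x ε)

open Topology in
lemma c11_comp_lip {X Y Z : Type*} [PseudoEMetricSpace X] [PseudoEMetricSpace Y]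
    [PseudoEMetricSpace Z] {g : Y → Z} {h : X → Y} {x : X}
    (hg : ∃ K : NNReal, ∃ s ∈ 𝓝 (h x), LipschitzOnWith K g s)
    (hh : ∃ K : NNReal, ∃ s ∈ 𝓝 x, LipschitzOnWith K h s) :
    ∃ K : NNReal, ∃ s ∈ 𝓝 x, LipschitzOnWith K (g ∘ h) s := by
  obtain ⟨K, s, hs, hg⟩ := hg
  obtain ⟨K', t, ht, hh⟩ := hh
  have hc : ContinuousAt h x := hh.continuousOn.continuousAt ht
  refine ⟨K * K', t ∩ h ⁻¹' s, Filter.inter_mem ht (hc hs), ?_⟩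
  exact hg.comp (hh.mono Set.inter_subset_left) (fun y hy => hy.2)

open Topology in
lemma c11_of_local {E F : Type*} [NormedAddCommGroup E] [NormedSpace ℝ E]
    [NormedAddCommGroup F] [NormedSpace ℝ F] {f : E → F} {U : Set E} (hU : IsOpen U)
    (h1 : ∀ x ∈ U, ContDiffAt ℝ 1 f x)
    (h2 : ∀ x ∈ U, ∃ K : NNReal, ∃ s ∈ 𝓝 x, LipschitzOnWith K (fderiv ℝ f) s) :
    IsC11On f U := by
  refine ⟨fun x hx => (h1 x hx).contDiffWithinAt, fun x hx => ?_⟩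
  obtain ⟨K, s, hs, hl⟩ := h2 x hx
  obtain ⟨ε, hε, hb⟩ := Metric.mem_nhds_iff.1 (Filter.inter_mem hs (hU.mem_nhds hx))
  exact ⟨ε, hε, fun y hy => (hb hy).2, K, hl.mono fun y hy => (hb hy).1⟩

lemma exists_straight_lin {n : ℕ} (L : EuclideanSpace ℝ (Fin n) →L[ℝ] ℝ) (hL : L ≠ 0) :
    ∃ (P : EuclideanSpace ℝ (Fin n) →L[ℝ] EuclideanSpace ℝ (Fin (n - 1)))
      (A : EuclideanSpace ℝ (Fin n) ≃L[ℝ] EuclideanSpace ℝ (Fin (n - 1)) × ℝ),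
      (A : EuclideanSpace ℝ (Fin n) →L[ℝ] EuclideanSpace ℝ (Fin (n - 1)) × ℝ) = P.prod L := by
  have hL' : (L : EuclideanSpace ℝ (Fin n) →ₗ[ℝ] ℝ) ≠ 0 := by
    intro h; apply hL; ext1 v; exact LinearMap.congr_fun h v
  have hk := Module.Dual.finrank_ker_add_one_of_ne_zero hL'
  rw [finrank_euclideanSpace_fin] at hk
  set N := LinearMap.ker (L : EuclideanSpace ℝ (Fin n) →ₗ[ℝ] ℝ) with hN
  have e : N ≃ₗ[ℝ] EuclideanSpace ℝ (Fin (n - 1)) :=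
    LinearEquiv.ofFinrankEq _ _ (by rw [finrank_euclideanSpace_fin]; omega)
  obtain ⟨q, hq⟩ := LinearMap.exists_leftInverse_of_injective N.subtype (Submodule.ker_subtype N)
  let P₀ := e.toLinearMap ∘ₗ q
  let A₀ := P₀.prod (L : EuclideanSpace ℝ (Fin n) →ₗ[ℝ] ℝ)
  have hinj : Function.Injective A₀ := by
    rw [← LinearMap.ker_eq_bot, LinearMap.ker_eq_bot']
    intro v hv
    have h1 : e (q v) = 0 := congrArg Prod.fst hv
    have h2 : L v = 0 := congrArg Prod.snd hv
    have h3 : q v = ⟨v, h2⟩ := LinearMap.congr_fun hq ⟨v, h2⟩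
    have h4 : q v = 0 := by simpa using h1
    rw [h4] at h3
    exact (congrArg Subtype.val h3).symm
  have hfr : Module.finrank ℝ (EuclideanSpace ℝ (Fin n))
      = Module.finrank ℝ (EuclideanSpace ℝ (Fin (n - 1)) × ℝ) := by
    rw [Module.finrank_prod, finrank_euclideanSpace_fin, finrank_euclideanSpace_fin,
      Module.finrank_self]
    omega
  let A := (LinearEquiv.ofInjectiveOfFinrankEq A₀ hinj hfr).toContinuousLinearEquiv
  refine ⟨LinearMap.toContinuousLinearMap P₀, A, ?_⟩
  ext1 v
  rfl

/-- **`C^{1,1}` straightening of a level set** (implicit function theorem for `C^{1,1}`):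
near a point where the gradient of a `C^{1,1}` function does not vanish, there is a
`C^{1,1}`-diffeomorphism `G : Ω₀ × (a,b) → V` with `f (G (y, t)) = t`. -/
theorem straightening_C11 {n : ℕ} {U : Set (EuclideanSpace ℝ (Fin n))} (hU : IsOpen U)
    {f : EuclideanSpace ℝ (Fin n) → ℝ} (hf : IsC11On f U)
    {x₀ : EuclideanSpace ℝ (Fin n)} (hx₀ : x₀ ∈ U) (hgrad : gradient f x₀ ≠ 0) :
    ∃ (V : Set (EuclideanSpace ℝ (Fin n))) (Ω₀ : Set (EuclideanSpace ℝ (Fin (n - 1))))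
      (a b : ℝ) (G : EuclideanSpace ℝ (Fin (n - 1)) × ℝ → EuclideanSpace ℝ (Fin n))
      (G' : EuclideanSpace ℝ (Fin n) → EuclideanSpace ℝ (Fin (n - 1)) × ℝ),
      IsOpen V ∧ V ⊆ U ∧ x₀ ∈ V ∧ IsOpen Ω₀ ∧ a < b ∧
      Set.BijOn G (Ω₀ ×ˢ Set.Ioo a b) V ∧
      Set.InvOn G' G (Ω₀ ×ˢ Set.Ioo a b) V ∧
      IsC11On G (Ω₀ ×ˢ Set.Ioo a b) ∧
      IsC11On G' V ∧
      ∀ p ∈ Ω₀ ×ˢ Set.Ioo a b, f (G p) = p.2 := by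
  have hfd : ∀ x ∈ U, ContDiffAt ℝ 1 f x := fun x hx => hf.1.contDiffAt (hU.mem_nhds hx)
  have hL : fderiv ℝ f x₀ ≠ 0 := by
    intro h; apply hgrad; rw [gradient, h, map_zero]
  obtain ⟨P, A, hA⟩ := exists_straight_lin (fderiv ℝ f x₀) hL
  let F : EuclideanSpace ℝ (Fin n) → EuclideanSpace ℝ (Fin (n - 1)) × ℝ := fun x => (P x, f x)
  have hF1 : ∀ x ∈ U, ContDiffAt ℝ 1 F x := fun x hx => P.contDiff.contDiffAt.prodMk (hfd x hx)
  have hFd : ∀ x ∈ U, HasFDerivAt F (P.prod (fderiv ℝ f x)) x := fun x hx =>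
    P.hasFDerivAt.prodMk ((hfd x hx).differentiableAt one_ne_zero).hasFDerivAt
  have hFlip : ∀ x ∈ U, ∃ K : NNReal, ∃ s ∈ nhds x, LipschitzOnWith K (fderiv ℝ F) s := by
    intro x hx
    obtain ⟨ε, hε, hb, K, hK⟩ := hf.2 x hx
    refine ⟨K, _, Metric.ball_mem_nhds x hε, LipschitzOnWith.of_dist_le_mul fun y hy z hz => ?_⟩
    rw [(hFd y (hb hy)).fderiv, (hFd z (hb hz)).fderiv]
    refine le_trans (le_of_eq ?_) (hK.dist_le_mul y hy z hz)
    have : P.prod (fderiv ℝ f y) - P.prod (fderiv ℝ f z)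
        = ContinuousLinearMap.prod 0 (fderiv ℝ f y - fderiv ℝ f z) := by
      ext1 v; simp
    rw [dist_eq_norm, this, ContinuousLinearMap.opNorm_prod, dist_eq_norm, Prod.norm_def]
    simp
  have hA0 : HasFDerivAt F
      (A : EuclideanSpace ℝ (Fin n) →L[ℝ] EuclideanSpace ℝ (Fin (n - 1)) × ℝ) x₀ := by
    rw [hA]; exact hFd x₀ hx₀
  let e := (hF1 x₀ hx₀).toOpenPartialHomeomorph F hA0 one_ne_zero
  have heF : ∀ x, e x = F x := fun x => rfl
  have hes : x₀ ∈ e.source := (hF1 x₀ hx₀).mem_toOpenPartialHomeomorph_source hA0 one_ne_zero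
  -- good set
  have hgood : {x | x ∈ U ∧ ∃ B : EuclideanSpace ℝ (Fin n) ≃L[ℝ]
      EuclideanSpace ℝ (Fin (n - 1)) × ℝ, HasFDerivAt F (B : EuclideanSpace ℝ (Fin n) →L[ℝ]
      EuclideanSpace ℝ (Fin (n - 1)) × ℝ) x} ∈ nhds x₀ := by
    have hc : ContinuousAt (fderiv ℝ F) x₀ := by
      obtain ⟨K, s, hs, hl⟩ := hFlip x₀ hx₀
      exact hl.continuousOn.continuousAt hs
    have h1 := hc (by rw [hA0.fderiv]; exact ContinuousLinearEquiv.nhds A)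
    filter_upwards [h1, hU.mem_nhds hx₀] with x hx hxU
    obtain ⟨B, hB⟩ := hx
    exact ⟨hxU, B, by rw [hB]; exact (hFd x hxU).differentiableAt.hasFDerivAt⟩
  have hW : e.target ∩ e.symm ⁻¹' (interior {x | x ∈ U ∧ ∃ B : EuclideanSpace ℝ (Fin n) ≃L[ℝ]
      EuclideanSpace ℝ (Fin (n - 1)) × ℝ, HasFDerivAt F (B : EuclideanSpace ℝ (Fin n) →L[ℝ]
      EuclideanSpace ℝ (Fin (n - 1)) × ℝ) x}) ∈ nhds (F x₀) := by
    refine (e.isOpen_inter_preimage_symm isOpen_interior).mem_nhds ⟨e.map_source hes, ?_⟩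
    rw [← heF, Set.mem_preimage, e.left_inv hes]
    exact mem_interior_iff_mem_nhds.2 hgood
  obtain ⟨ε, hε, hball⟩ := Metric.mem_nhds_iff.1 hW
  have hprod : Metric.ball (P x₀) ε ×ˢ Set.Ioo (f x₀ - ε) (f x₀ + ε) = Metric.ball (F x₀) ε := by
    rw [← Real.ball_eq_Ioo, ball_prod_same]
  have hsub : ∀ p ∈ Metric.ball (F x₀) ε, p ∈ e.target ∧ e.symm p ∈ U ∧
      ∃ B : EuclideanSpace ℝ (Fin n) ≃L[ℝ]
      EuclideanSpace ℝ (Fin (n - 1)) × ℝ, HasFDerivAt F (B : EuclideanSpace ℝ (Fin n) →L[ℝ]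
      EuclideanSpace ℝ (Fin (n - 1)) × ℝ) (e.symm p) := by
    intro p hp
    have := interior_subset (Set.mem_preimage.1 (hball hp).2)
    exact ⟨(hball hp).1, this⟩
  refine ⟨e.source ∩ e ⁻¹' Metric.ball (F x₀) ε, Metric.ball (P x₀) ε, f x₀ - ε, f x₀ + ε,
    e.symm, F, e.isOpen_inter_preimage Metric.isOpen_ball, ?_, ⟨hes, Metric.mem_ball_self hε⟩,
    Metric.isOpen_ball, by linarith, ?_⟩
  · rintro x ⟨hx, hx'⟩
    have := (hsub _ hx').2.1
    rwa [e.left_inv hx] at this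
  rw [hprod]
  have hinv : Set.InvOn F e.symm (Metric.ball (F x₀) ε)
      (e.source ∩ e ⁻¹' Metric.ball (F x₀) ε) :=
    ⟨fun p hp => e.right_inv (hsub p hp).1, fun x hx => e.left_inv hx.1⟩
  have hG1 : ∀ p ∈ Metric.ball (F x₀) ε, ContDiffAt ℝ 1 e.symm p := by
    intro p hp
    obtain ⟨h1, h2, B, hB⟩ := hsub p hp
    exact e.contDiffAt_symm h1 hB (hF1 _ h2)
  refine ⟨hinv.bijOn (fun p hp => ⟨e.map_target (hsub p hp).1, ?_⟩) (fun x hx => hx.2), hinv,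
    c11_of_local Metric.isOpen_ball hG1 ?_, ?_, ?_⟩
  · rwa [Set.mem_preimage, e.right_inv (hsub p hp).1]
  · intro p hp
    have hcomp : ∃ K : NNReal, ∃ s ∈ nhds p, LipschitzOnWith K
        (ContinuousLinearMap.inverse ∘ (fderiv ℝ F ∘ e.symm)) s := by
      obtain ⟨h1, h2, B, hB⟩ := hsub p hp
      refine c11_comp_lip ?_ (c11_comp_lip (hFlip _ h2) (hG1 p hp).exists_lipschitzOnWith)
      have := contDiffAt_map_inverse (𝕜 := ℝ) (n := 1) B
      rw [← hB.fderiv] at this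
      exact this.exists_lipschitzOnWith
    obtain ⟨K, s, hs, hK⟩ := hcomp
    refine ⟨K, s ∩ Metric.ball (F x₀) ε,
      Filter.inter_mem hs (Metric.isOpen_ball.mem_nhds hp), ?_⟩
    have hEq : Set.EqOn (fderiv ℝ e.symm) (ContinuousLinearMap.inverse ∘ (fderiv ℝ F ∘ e.symm))
        (s ∩ Metric.ball (F x₀) ε) := ?_
    · intro y hy z hz
      rw [hEq hy, hEq hz]
      exact hK hy.1 hz.1
    intro q hq
    obtain ⟨h1, h2, B, hB⟩ := hsub q hq.2
    have h3 : HasFDerivAt e.symm _ q := e.hasFDerivAt_symm h1 hB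
    simp only [Function.comp]
    rw [h3.fderiv, hB.fderiv, ContinuousLinearMap.inverse_equiv]
  · have hVU : ∀ x ∈ e.source ∩ e ⁻¹' Metric.ball (F x₀) ε, x ∈ U := by
      rintro x ⟨hx, hx'⟩
      have := (hsub _ hx').2.1
      rwa [e.left_inv hx] at this
    exact c11_of_local (e.isOpen_inter_preimage Metric.isOpen_ball)
      (fun x hx => hF1 x (hVU x hx)) (fun x hx => hFlip x (hVU x hx))
  · intro p hp
    exact congrArg Prod.snd (e.right_inv (hsub p hp).1)
end

section
/- For x, y ∈ ℝⁿ and maps f : {x,y} → ℝ, V : {x,y} → ℝⁿ, let ‖(f,V)‖_{x,y} denote the least M ≥ 0 such that |f(x)| ≤ M, ‖V(x)‖ ≤ M, ‖V(y) − V(x)‖ ≤ M‖y − x‖, and |f(x) + ⟨V(x), y − x⟩ − f(y)| ≤ M‖y − x‖². For every n and every R ≥ 1 there exists a constant C(n,R) > 0 with the following property. Let K₁, K₂ ⊆ ℝⁿ be open convex sets and let φ : K₁ → K₂ be a C¹-diffeomorphism whose inverse ψ = φ⁻¹ satisfies ‖ψ‖_{C^{1,1}} ≤ R, where ‖ψ‖_{C^{1,1}}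 = sup_{x∈K₂}(|ψ(x)| + ‖ψ′(x)‖_op) + sup_{x≠y∈K₂} ‖ψ′(x) − ψ′(y)‖_op/‖x−y‖. Let x, y ∈ K₂, f : {x,y} → ℝ, V : {x,y} → ℝⁿ, set x̃ = ψ(x), ỹ = ψ(y), f̃ = f ∘ φ on {x̃,ỹ}, and Ṽ(x̃) = φ′(x̃)ᵀ V(x), Ṽ(ỹ) = φ′(ỹ)ᵀ V(y). Then ‖(f,V)‖_{x,y} ≤ C(n,R)·‖(f̃,Ṽ)‖_{x̃,ỹ}. -/
open scoped InnerProductSpace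

/-- For points `x, y ∈ ℝⁿ` and data `f : {x,y} → ℝ`, `V : {x,y} → ℝⁿ`, the quantity
`‖(f,V)‖_{x,y}`: the least `M ≥ 0` such that `|f x| ≤ M`, `‖V x‖ ≤ M`,
`‖V y - V x‖ ≤ M ‖y - x‖` and `|f x + ⟨V x, y - x⟩ - f y| ≤ M ‖y - x‖²`. -/
noncomputable def pairNorm {n : ℕ} (f : EuclideanSpace ℝ (Fin n) → ℝ)
    (V : EuclideanSpace ℝ (Fin n) → EuclideanSpace ℝ (Fin n))
    (x y : EuclideanSpace ℝ (Fin n)) : ℝ :=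
  sInf {M : ℝ | 0 ≤ M ∧ |f x| ≤ M ∧ ‖V x‖ ≤ M ∧ ‖V y - V x‖ ≤ M * ‖y - x‖ ∧
    |f x + ⟪V x, y - x⟫_ℝ - f y| ≤ M * ‖y - x‖ ^ 2}

/-- Change of variables estimate for the Whitney data norm `‖(f,V)‖_{x,y}` under a
`C¹`-diffeomorphism `φ : K₁ → K₂` between open convex sets whose inverse `ψ` has
`C^{1,1}`-norm at most `R`: `‖(f,V)‖_{x,y} ≤ C(n,R) ‖(f̃,Ṽ)‖_{x̃,ỹ}`, where `f̃ = f ∘ φ`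
and `Ṽ` is the pullback of `V` (via the transposed Jacobian of `φ`). -/
theorem pairNorm_pullback (n : ℕ) (R : ℝ) (hR : 1 ≤ R) :
    ∃ C : ℝ, 0 < C ∧
      ∀ (K₁ K₂ : Set (EuclideanSpace ℝ (Fin n)))
        (φ ψ : EuclideanSpace ℝ (Fin n) → EuclideanSpace ℝ (Fin n)),
        IsOpen K₁ → Convex ℝ K₁ → IsOpen K₂ → Convex ℝ K₂ →
        Set.BijOn φ K₁ K₂ → Set.InvOn ψ φ K₁ K₂ →
        ContDiffOn ℝ 1 φ K₁ → ContDiffOn ℝ 1 ψ K₂ →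
        -- `sup_{x ∈ K₂} (|ψ x| + ‖ψ'(x)‖) + sup_{x' ≠ y' ∈ K₂} ‖ψ'(x') - ψ'(y')‖/‖x' - y'‖ ≤ R`
        (∀ x ∈ K₂, ‖ψ x‖ + ‖fderiv ℝ ψ x‖ ≤ R) →
        (∀ x ∈ K₂, ∀ x' ∈ K₂, ∀ y' ∈ K₂, x' ≠ y' →
          ‖ψ x‖ + ‖fderiv ℝ ψ x‖ + ‖fderiv ℝ ψ x' - fderiv ℝ ψ y'‖ / ‖x' - y'‖ ≤ R) →
        ∀ x ∈ K₂, ∀ y ∈ K₂,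
        ∀ (f : EuclideanSpace ℝ (Fin n) → ℝ)
          (V : EuclideanSpace ℝ (Fin n) → EuclideanSpace ℝ (Fin n)),
          pairNorm f V x y ≤
            C * pairNorm (f ∘ φ)
              (fun z => ContinuousLinearMap.adjoint (fderiv ℝ φ z) (V (φ z))) (ψ x) (ψ y) := by
  classical
  refine ⟨R ^ 2 + R, by positivity, ?_⟩
  intro K₁ K₂ φ ψ hK₁ _ hK₂ hc₂ hbij hinv hφ hψ h1 h2 x hx y hy f V
  have hR0 : 0 ≤ R := by linarith
  have hlip : ∀ a ∈ K₂, ∀ b ∈ K₂, ‖fderiv ℝ ψ a - fderiv ℝ ψ b‖ ≤ R * ‖a - b‖ := by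
    intro a ha b hb
    by_cases hab : a = b
    · simp [hab]
    · have h := h2 a ha a ha b hb hab
      have hpos : 0 < ‖a - b‖ := norm_pos_iff.2 (sub_ne_zero.2 hab)
      rw [← div_le_iff₀ hpos]
      have := norm_nonneg (ψ a)
      have := norm_nonneg (fderiv ℝ ψ a)
      linarith
  have hbd : ∀ a ∈ K₂, ‖fderiv ℝ ψ a‖ ≤ R := by
    intro a ha
    have := h1 a ha
    have := norm_nonneg (ψ a)
    linarith
  have hdψ : ∀ a ∈ K₂, DifferentiableAt ℝ ψ a := fun a ha =>
    (hψ.differentiableOn (by norm_num)).differentiableAt (hK₂.mem_nhds ha)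
  have hdφ : ∀ a ∈ K₁, DifferentiableAt ℝ φ a := fun a ha =>
    (hφ.differentiableOn (by norm_num)).differentiableAt (hK₁.mem_nhds ha)
  have hφψ : ∀ a ∈ K₂, φ (ψ a) = a := fun a ha => hinv.2 ha
  have hmem : ∀ a ∈ K₂, ψ a ∈ K₁ := by
    intro a ha
    obtain ⟨z, hz, rfl⟩ := hbij.surjOn ha
    rw [hinv.1 hz]; exact hz
  have hadj : ∀ a ∈ K₂, ContinuousLinearMap.adjoint (fderiv ℝ ψ a)
      (ContinuousLinearMap.adjoint (fderiv ℝ φ (ψ a)) (V (φ (ψ a)))) = V a := by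
    intro a ha
    have hcomp : (fderiv ℝ φ (ψ a)).comp (fderiv ℝ ψ a) = ContinuousLinearMap.id ℝ _ := by
      rw [← fderiv_comp a (hdφ _ (hmem a ha)) (hdψ a ha)]
      have : φ ∘ ψ =ᶠ[nhds a] id := by
        filter_upwards [hK₂.mem_nhds ha] with z hz using hφψ z hz
      rw [this.fderiv_eq, fderiv_id]
    rw [hφψ a ha, ← ContinuousLinearMap.comp_apply, ← ContinuousLinearMap.adjoint_comp, hcomp]
    refine ext_inner_right ℝ fun v => ?_
    rw [ContinuousLinearMap.adjoint_inner_left]; rfl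
  have hseg : segment ℝ x y ⊆ K₂ := hc₂.segment_subset hx hy
  have hT : ‖ψ y - ψ x‖ ≤ R * ‖y - x‖ :=
    hc₂.norm_image_sub_le_of_norm_fderiv_le hdψ hbd hx hy
  have hT2 : ‖ψ y - ψ x - fderiv ℝ ψ x (y - x)‖ ≤ R * ‖y - x‖ * ‖y - x‖ := by
    refine (convex_segment x y).norm_image_sub_le_of_norm_fderiv_le'
      (fun z hz => hdψ z (hseg hz)) ?_ (left_mem_segment ℝ x y) (right_mem_segment ℝ x y)
    intro z hz
    refine (hlip z (hseg hz) x hx).trans ?_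
    gcongr
    have := norm_sub_le_of_mem_segment hz
    simpa [norm_sub_rev] using this
  have hAx := hadj x hx
  have hAy := hadj y hy
  unfold pairNorm
  simp only [Function.comp_apply]
  generalize hWx : ContinuousLinearMap.adjoint (fderiv ℝ φ (ψ x)) (V (φ (ψ x))) = Wx at *
  generalize hWy : ContinuousLinearMap.adjoint (fderiv ℝ φ (ψ y)) (V (φ (ψ y))) = Wy at *
  rw [hφψ x hx, hφψ y hy]
  have hC : 0 < R ^ 2 + R := by positivity
  rw [← div_le_iff₀' hC]
  apply le_csInf
  · by_cases hxy : x = y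
    · subst hxy
      refine ⟨|f x| + ‖Wx‖, by positivity, ?_, ?_, ?_, ?_⟩
      · have := norm_nonneg Wx; linarith
      · have := abs_nonneg (f x); linarith
      · simp [← hWx, ← hWy]
      · simp
    · have hne : ψ y ≠ ψ x := fun h => hxy (by rw [← hφψ x hx, ← h, hφψ y hy])
      have hp : 0 < ‖ψ y - ψ x‖ := norm_pos_iff.2 (sub_ne_zero.2 hne)
      have a1 : 0 ≤ ‖Wy - Wx‖ / ‖ψ y - ψ x‖ := by positivity
      have a2 : 0 ≤ |f x + ⟪Wx, ψ y - ψ x⟫_ℝ - f y| / ‖ψ y - ψ x‖ ^ 2 := by positivity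
      have a3 := norm_nonneg Wx
      have a4 := abs_nonneg (f x)
      refine ⟨|f x| + ‖Wx‖ + ‖Wy - Wx‖ / ‖ψ y - ψ x‖ +
        |f x + ⟪Wx, ψ y - ψ x⟫_ℝ - f y| / ‖ψ y - ψ x‖ ^ 2, by positivity, ?_, ?_, ?_, ?_⟩
      · linarith
      · linarith
      · rw [← div_le_iff₀ hp]; linarith
      · rw [← div_le_iff₀ (by positivity)]; linarith
  · rintro M ⟨hM, m1, m2, m3, m4⟩
    rw [div_le_iff₀' hC]
    refine csInf_le ⟨0, fun _ h => h.1⟩ ⟨by positivity, ?_, ?_, ?_, ?_⟩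
    · nlinarith
    · rw [← hAx]
      refine (ContinuousLinearMap.le_opNorm _ _).trans ?_
      rw [LinearIsometryEquiv.norm_map]
      calc _ ≤ R * M := mul_le_mul (hbd x hx) m2 (norm_nonneg _) hR0
        _ ≤ _ := by nlinarith [mul_nonneg (sq_nonneg R) hM]
    · have e : V y - V x = ContinuousLinearMap.adjoint (fderiv ℝ ψ y) (Wy - Wx) +
          ContinuousLinearMap.adjoint (fderiv ℝ ψ y - fderiv ℝ ψ x) Wx := by
        rw [← hAx, ← hAy, map_sub, map_sub]; simp
      rw [e]
      refine (norm_add_le _ _).trans ?_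
      have b1 := (ContinuousLinearMap.adjoint (fderiv ℝ ψ y)).le_opNorm (Wy - Wx)
      have b2 := (ContinuousLinearMap.adjoint (fderiv ℝ ψ y - fderiv ℝ ψ x)).le_opNorm Wx
      rw [LinearIsometryEquiv.norm_map] at b1 b2
      have c1 : ‖fderiv ℝ ψ y‖ * ‖Wy - Wx‖ ≤ R * (M * (R * ‖y - x‖)) :=
        mul_le_mul (hbd y hy) (m3.trans (by gcongr)) (norm_nonneg _) hR0
      have c2 : ‖fderiv ℝ ψ y - fderiv ℝ ψ x‖ * ‖Wx‖ ≤ R * ‖y - x‖ * M :=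
        mul_le_mul (hlip y hy x hx) m2 (norm_nonneg _) (by positivity)
      linarith
    · have e : f x + ⟪V x, y - x⟫_ℝ - f y = (f x + ⟪Wx, ψ y - ψ x⟫_ℝ - f y) -
          ⟪Wx, ψ y - ψ x - fderiv ℝ ψ x (y - x)⟫_ℝ := by
        rw [← hAx, ContinuousLinearMap.adjoint_inner_left, inner_sub_right _ (ψ y - ψ x)]; ring
      rw [e]
      refine (abs_sub _ _).trans ?_
      have c1 : M * ‖ψ y - ψ x‖ ^ 2 ≤ M * (R * ‖y - x‖) ^ 2 := by gcongr
      have c2 := abs_real_inner_le_norm Wx (ψ y - ψ x - fderiv ℝ ψ x (y - x))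
      have c3 : ‖Wx‖ * ‖ψ y - ψ x - fderiv ℝ ψ x (y - x)‖ ≤ M * (R * ‖y - x‖ * ‖y - x‖) :=
        mul_le_mul m2 hT2 (norm_nonneg _) hM
      linarith
end

section
/- Let U ⊆ ℝⁿ be an open set and let f : U → ℝ be a C¹ function whose gradient ∇f is locally Lipschitz on U (a C^{1,1}-function). Then for Lebesgue-almost every x ∈ U the map ∇f : U → ℝⁿ is differentiable at x, and its derivative at x is a symmetric linear map; equivalently, the partial derivatives ∂_i f and ∂_j f are differentiable almost everywhere in U and ∂_i(∂_j f) = ∂_j(∂_i f) almost everywhere in U, for all i,j ∈ {1,…,n}. -/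
open scoped InnerProductSpace

/-- For a `C¹` function with locally Lipschitz gradient on an open set `U ⊆ ℝⁿ`, the gradient
is differentiable almost everywhere in `U` and its derivative is almost everywhere a symmetric
linear map (equality of mixed second partial derivatives almost everywhere). -/
theorem ae_symmetric_second_derivative {n : ℕ} (U : Set (EuclideanSpace ℝ (Fin n)))
    (hU : IsOpen U) (f : EuclideanSpace ℝ (Fin n) → ℝ)
    (hf : ContDiffOn ℝ 1 f U)
    (hlip : ∀ x ∈ U, ∃ ε > 0, Metric.ball x ε ⊆ U ∧
      ∃ K : NNReal, LipschitzOnWith K (gradient f) (Metric.ball x ε)) :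
    ∀ᵐ x ∂(MeasureTheory.volume.restrict U),
      DifferentiableAt ℝ (gradient f) x ∧
        ∀ v w : EuclideanSpace ℝ (Fin n),
          ⟪fderiv ℝ (gradient f) x v, w⟫_ℝ = ⟪fderiv ℝ (gradient f) x w, v⟫_ℝ := by
  have key : ∀ x ∈ U, DifferentiableAt ℝ (gradient f) x →
      ∀ v w : EuclideanSpace ℝ (Fin n),
          ⟪fderiv ℝ (gradient f) x v, w⟫_ℝ = ⟪fderiv ℝ (gradient f) x w, v⟫_ℝ := by
    intro x hx hd v w
    have h1 : ∀ᶠ y in nhds x, HasFDerivAt f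
        (innerSL ℝ (gradient f y)) y := by
      filter_upwards [hU.mem_nhds hx] with y hy
      have h2 : DifferentiableAt ℝ f y :=
        (hf.differentiableOn (by norm_num)).differentiableAt (hU.mem_nhds hy)
      exact h2.hasGradientAt.hasFDerivAt
    have h3 : HasFDerivAt (fun y => innerSL ℝ (gradient f y))
        ((innerSL ℝ).comp (fderiv ℝ (gradient f) x)) x :=
      (innerSL ℝ (E := EuclideanSpace ℝ (Fin n))).hasFDerivAt.comp x hd.hasFDerivAt
    have h4 := second_derivative_symmetric_of_eventually_of_real h1 h3 v w
    simpa using h4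
  rw [MeasureTheory.ae_restrict_iff' hU.measurableSet]
  have main : ∀ᵐ x ∂(MeasureTheory.volume : MeasureTheory.Measure (EuclideanSpace ℝ (Fin n))),
      x ∈ U → DifferentiableAt ℝ (gradient f) x := by
    rw [MeasureTheory.ae_iff]
    refine MeasureTheory.measure_null_of_locally_null _ ?_
    intro x hx
    simp only [Set.mem_setOf_eq, Classical.not_imp] at hx
    obtain ⟨ε, hε, hb, K, hK⟩ := hlip x hx.1
    refine ⟨{y | ¬ (y ∈ Metric.ball x ε → DifferentiableAt ℝ (gradient f) y)}, ?_, ?_⟩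
    · filter_upwards [self_mem_nhdsWithin,
        mem_nhdsWithin_of_mem_nhds (Metric.ball_mem_nhds x hε)] with y hy hy2
      simp only [Set.mem_setOf_eq, Classical.not_imp] at hy ⊢
      exact ⟨hy2, hy.2⟩
    · rw [← MeasureTheory.ae_iff]
      filter_upwards [hK.ae_differentiableWithinAt_of_mem
        (μ := MeasureTheory.volume)] with y hy hy2
      exact (hy hy2).differentiableAt (Metric.isOpen_ball.mem_nhds hy2)
  filter_upwards [main] with x hx hxU
  exact ⟨hx hxU, key x hxU (hx hxU)⟩
end

section
/- Let (M,d) be a locally compact, separable metric space and let μ be a Borel measure on M. Let f : M → ℝ be μ-integrable with ∫_M f dμ = 0, and assume there exists x₀ ∈ M with ∫_M |f(x)|·d(x₀,x) dμ(x) < ∞. Then for every 1-Lipschitz v : M → ℝ the integral ∫_M v f dμ is well-defined and finite, and there exists a 1-Lipschitz function u : M → ℝ attaining the supremum: ∫_M u f dμ = sup { ∫_M v f dμ : v : M → ℝ, v is 1-Lipschitz }. -/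
open MeasureTheory

/-- Existence of a maximizer in the dual Monge–Kantorovich problem: on a locally compact,
separable metric space with a Borel measure `μ`, if `f` is `μ`-integrable with `∫ f dμ = 0`
and `∫ |f(x)| d(x₀,x) dμ(x) < ∞`, then `∫ v f dμ` is well defined for every `1`-Lipschitz `v`,
and some `1`-Lipschitz function `u` attains the supremum of `v ↦ ∫ v f dμ`. -/
theorem exists_kantorovich_maximizer {X : Type*} [MetricSpace X] [LocallyCompactSpace X]
    [TopologicalSpace.SeparableSpace X] [MeasurableSpace X] [BorelSpace X]
    (μ : Measure X) (f : X → ℝ) (hf : Integrable f μ) (hf0 : ∫ x, f x ∂μ = 0)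
    (x₀ : X) (hfd : Integrable (fun x => |f x| * dist x₀ x) μ) :
    (∀ v : X → ℝ, LipschitzWith 1 v → Integrable (fun x => v x * f x) μ) ∧
    ∃ u : X → ℝ, LipschitzWith 1 u ∧
      ∀ v : X → ℝ, LipschitzWith 1 v → ∫ x, v x * f x ∂μ ≤ ∫ x, u x * f x ∂μ := by
  have hbound : ∀ v : X → ℝ, LipschitzWith 1 v → v x₀ = 0 → ∀ x, |v x| ≤ dist x₀ x := by
    intro v hv h0 x
    have := hv.dist_le_mul x x₀
    rw [Real.dist_eq, h0, dist_comm x x₀] at this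
    simpa using this
  have hmeas : ∀ v : X → ℝ, LipschitzWith 1 v → AEStronglyMeasurable (fun x => v x * f x) μ := by
    intro v hv
    exact (hv.continuous.measurable.aestronglyMeasurable).mul hf.aestronglyMeasurable
  have hle : ∀ v : X → ℝ, LipschitzWith 1 v → v x₀ = 0 →
      ∀ x, ‖v x * f x‖ ≤ |f x| * dist x₀ x := by
    intro v hv h0 x
    rw [Real.norm_eq_abs, abs_mul, mul_comm]
    exact mul_le_mul_of_nonneg_left (hbound v hv h0 x) (abs_nonneg _)
  have hint0 : ∀ v : X → ℝ, LipschitzWith 1 v → v x₀ = 0 →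
      Integrable (fun x => v x * f x) μ := by
    intro v hv h0
    exact hfd.mono' (hmeas v hv) (Filter.Eventually.of_forall (hle v hv h0))
  have hsub : ∀ v : X → ℝ, LipschitzWith 1 v → LipschitzWith 1 (fun x => v x - v x₀) := by
    intro v hv
    refine LipschitzWith.of_dist_le_mul fun x y => ?_
    have := hv.dist_le_mul x y
    simpa [dist_sub_right] using this
  have hint : ∀ v : X → ℝ, LipschitzWith 1 v → Integrable (fun x => v x * f x) μ := by
    intro v hv
    have h1 := (hint0 _ (hsub v hv) (by simp)).add (hf.const_mul (v x₀))
    refine h1.congr (Filter.Eventually.of_forall fun x => ?_)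
    simp only [Pi.add_apply]
    ring
  have heq : ∀ v : X → ℝ, LipschitzWith 1 v →
      ∫ x, v x * f x ∂μ = ∫ x, (v x - v x₀) * f x ∂μ := by
    intro v hv
    have : ∀ x, (v x - v x₀) * f x = v x * f x - v x₀ * f x := fun x => by ring
    simp_rw [this]
    rw [integral_sub (hint v hv) (hf.const_mul _), integral_const_mul, hf0]
    simp
  refine ⟨hint, ?_⟩
  let K : Set (X → ℝ) := {v | LipschitzWith 1 v ∧ v x₀ = 0}
  have hKc : IsCompact K := by
    refine (isCompact_univ_pi (fun x : X => isCompact_Icc (a := -dist x₀ x)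
      (b := dist x₀ x))).of_isClosed_subset ?_ ?_
    · have : K = (⋂ x, ⋂ y, {v : X → ℝ | dist (v x) (v y) ≤ dist x y}) ∩ {v | v x₀ = 0} := by
        ext v
        simp [K, lipschitzWith_iff_dist_le_mul]
      rw [this]
      refine IsClosed.inter (isClosed_iInter fun x => isClosed_iInter fun y => ?_) ?_
      · exact isClosed_le ((continuous_apply x).dist (continuous_apply y)) continuous_const
      · exact isClosed_eq (continuous_apply x₀) continuous_const
    · intro v hv x _
      exact abs_le.1 (hbound v hv.1 hv.2 x)
  haveI : Nonempty X := ⟨x₀⟩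
  let D := TopologicalSpace.denseSeq X
  let r : (X → ℝ) → (ℕ → ℝ) := fun v n => v (D n)
  have hr : Continuous r := continuous_pi fun n => continuous_apply (D n)
  have hrK := (hKc.image hr).isSeqCompact
  let I : (X → ℝ) → ℝ := fun v => ∫ x, v x * f x ∂μ
  have hne : (I '' K).Nonempty :=
    ⟨_, _, ⟨(LipschitzWith.const (0:ℝ)).weaken zero_le_one, rfl⟩, rfl⟩
  have hbdd : BddAbove (I '' K) := by
    refine ⟨∫ x, |f x| * dist x₀ x ∂μ, ?_⟩
    rintro _ ⟨v, hv, rfl⟩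
    exact integral_mono (hint0 v hv.1 hv.2) hfd
      fun x => (le_abs_self _).trans (hle v hv.1 hv.2 x)
  obtain ⟨a, -, ha, haK⟩ := exists_seq_tendsto_sSup hne hbdd
  choose w hwK hwa using haK
  obtain ⟨_, ⟨u, huK, rfl⟩, φ, hφ, hlim⟩ := hrK (fun n => Set.mem_image_of_mem r (hwK n))
  have hD : ∀ n, Filter.Tendsto (fun k => w (φ k) (D n)) Filter.atTop (nhds (u (D n))) :=
    fun n => (tendsto_pi_nhds.1 hlim) n
  have hpt : ∀ x, Filter.Tendsto (fun k => w (φ k) x) Filter.atTop (nhds (u x)) := by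
    intro x
    rw [Metric.tendsto_atTop]
    intro ε hε
    obtain ⟨n, hn⟩ := (TopologicalSpace.denseRange_denseSeq X).exists_dist_lt x
      (show 0 < ε / 3 by positivity)
    obtain ⟨N, hN⟩ := (Metric.tendsto_atTop.1 (hD n)) (ε / 3) (by positivity)
    refine ⟨N, fun k hk => ?_⟩
    have h1 := (hwK (φ k)).1.dist_le_mul x (D n)
    have h2 := huK.1.dist_le_mul (D n) x
    have h3 := hN k hk
    have h4 := dist_triangle4 (w (φ k) x) (w (φ k) (D n)) (u (D n)) (u x)
    rw [dist_comm (D n) x] at h2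
    simp only [NNReal.coe_one, one_mul] at h1 h2
    change dist x (D n) < ε / 3 at hn
    linarith
  have hI : Filter.Tendsto (fun k => I (w (φ k))) Filter.atTop (nhds (I u)) :=
    tendsto_integral_of_dominated_convergence (fun x => |f x| * dist x₀ x)
      (fun k => hmeas _ (hwK (φ k)).1) hfd
      (fun k => Filter.Eventually.of_forall (hle _ (hwK (φ k)).1 (hwK (φ k)).2))
      (Filter.Eventually.of_forall fun x => (hpt x).mul_const (f x))
  have hsup : I u = sSup (I '' K) := by
    refine tendsto_nhds_unique hI ?_
    simp_rw [hwa]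
    exact ha.comp hφ.tendsto_atTop
  refine ⟨u, huK.1, fun v hv => ?_⟩
  rw [heq v hv]
  change I (fun x => v x - v x₀) ≤ I u
  rw [hsup]
  exact le_csSup hbdd ⟨_, ⟨hsub v hv, by simp⟩, rfl⟩
end

section
/- Let (M,d) be a metric space and u : M → ℝ a 1-Lipschitz function. A transport ray associated with u is a subset I ⊆ M, maximal with respect to inclusion, such that |u(x) − u(y)| = d(x,y) for all x,y ∈ I. Let K ⊆ M be compact, let A be the union of all transport rays that intersect K, and for δ > 0 set u_δ(x) = inf_{y∈M} [u(y) + d(x,y) − δ·1_K(y)]. Then: (a) 0 ≤ u(x) − u_δ(x) ≤ δ for all x ∈ M and δ > 0; (b) for each x ∈ M the function δ ↦ (u(x) − u_δ(x))/δ is nondecreasing in δ > 0, so the limit L(x) = lim_{δ→0⁺} (u(x) − u_δ(x))/δ exists and lies in [0,1]; (c) L(x) = 0 for every x ∈ M \ A and L(x) = 1 for every x ∈ K. -/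
open Filter

/-- A transport ray associated with a `1`-Lipschitz function `u` on a metric space: a maximal
set on which `u` changes exactly like the distance. -/
def IsTransportRay {X : Type*} [MetricSpace X] (u : X → ℝ) (I : Set X) : Prop :=
  (∀ x ∈ I, ∀ y ∈ I, |u x - u y| = dist x y) ∧
    ∀ J : Set X, I ⊆ J → (∀ x ∈ J, ∀ y ∈ J, |u x - u y| = dist x y) → J = I

/-- The perturbed potential `u_δ(x) = inf_y [u(y) + d(x,y) - δ·1_K(y)]`. -/
noncomputable def uDelta {X : Type*} [MetricSpace X] (u : X → ℝ) (K : Set X)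
    (δ : ℝ) (x : X) : ℝ :=
  ⨅ y : X, (u y + dist x y - δ * Set.indicator K (fun _ => (1 : ℝ)) y)

theorem exists_ray_aux {X : Type*} [MetricSpace X] (u : X → ℝ) (S : Set X)
    (hS : ∀ x ∈ S, ∀ y ∈ S, |u x - u y| = dist x y) :
    ∃ I, S ⊆ I ∧ IsTransportRay u I := by
  obtain ⟨I, hSI, hI⟩ := zorn_subset_nonempty
    {I : Set X | ∀ x ∈ I, ∀ y ∈ I, |u x - u y| = dist x y} (by
      intro c hc hchain _
      refine ⟨⋃₀ c, ?_, fun s hs => Set.subset_sUnion_of_mem hs⟩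
      rintro x ⟨s, hs, hxs⟩ y ⟨t, ht, hyt⟩
      rcases hchain.total hs ht with h | h
      · exact hc ht x (h hxs) y hyt
      · exact hc hs x hxs y (h hyt)) S hS
  refine ⟨I, hSI, hI.prop, fun J hIJ hJ => ?_⟩
  exact Set.Subset.antisymm (hI.le_of_ge hJ hIJ) hIJ

/-- Properties of `u_δ`: (a) `0 ≤ u - u_δ ≤ δ`; (b) `δ ↦ (u - u_δ)/δ` is nondecreasing in
`δ > 0`, hence has a limit `L(x) ∈ [0,1]` as `δ → 0⁺`; (c) the limit `L` vanishes off the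
union `A` of all transport rays meeting the compact set `K`, and equals `1` on `K`. -/
theorem uDelta_properties {X : Type*} [MetricSpace X] (u : X → ℝ)
    (hu : LipschitzWith 1 u) (K : Set X) (hK : IsCompact K) :
    (∀ δ > 0, ∀ x : X, 0 ≤ u x - uDelta u K δ x ∧ u x - uDelta u K δ x ≤ δ) ∧
    (∀ x : X, ∀ δ₁ δ₂ : ℝ, 0 < δ₁ → δ₁ ≤ δ₂ →
      (u x - uDelta u K δ₁ x) / δ₁ ≤ (u x - uDelta u K δ₂ x) / δ₂) ∧
    ∃ L : X → ℝ,
      (∀ x : X, L x ∈ Set.Icc (0 : ℝ) 1 ∧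
        Tendsto (fun δ => (u x - uDelta u K δ x) / δ) (nhdsWithin 0 (Set.Ioi 0))
          (nhds (L x))) ∧
      (∀ x : X, x ∉ ⋃₀ {I : Set X | IsTransportRay u I ∧ (I ∩ K).Nonempty} → L x = 0) ∧
      (∀ x ∈ K, L x = 1) := by
  classical
  have hl : ∀ x y, u x ≤ u y + dist x y := by
    intro x y
    have := hu.dist_le_mul x y
    rw [Real.dist_eq] at this
    have h2 := le_abs_self (u x - u y)
    simp at this
    linarith
  have hi0 : ∀ y, 0 ≤ Set.indicator K (fun _ => (1 : ℝ)) y := fun y =>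
    Set.indicator_nonneg (fun _ _ => zero_le_one) y
  have hi1 : ∀ y, Set.indicator K (fun _ => (1 : ℝ)) y ≤ 1 := fun y =>
    Set.indicator_le_self' (fun _ _ => zero_le_one) y
  have hb : ∀ δ > 0, ∀ x y, u x - δ ≤
      u y + dist x y - δ * Set.indicator K (fun _ => (1 : ℝ)) y := by
    intro δ hδ x y
    have := hl x y
    nlinarith [hi1 y]
  have hle : ∀ δ > 0, ∀ x y, uDelta u K δ x ≤
      u y + dist x y - δ * Set.indicator K (fun _ => (1 : ℝ)) y := by
    intro δ hδ x y
    refine ciInf_le ⟨u x - δ, ?_⟩ y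
    rintro _ ⟨z, rfl⟩
    exact hb δ hδ x z
  have hge : ∀ δ x c, (∀ y, c ≤
      u y + dist x y - δ * Set.indicator K (fun _ => (1 : ℝ)) y) → c ≤ uDelta u K δ x := by
    intro δ x c h
    haveI : Nonempty X := ⟨x⟩
    exact le_ciInf h
  have ha : ∀ δ > 0, ∀ x : X, 0 ≤ u x - uDelta u K δ x ∧ u x - uDelta u K δ x ≤ δ := by
    intro δ hδ x
    constructor
    · have := hle δ hδ x x
      rw [dist_self] at this
      nlinarith [hi0 x]
    · linarith [hge δ x _ (hb δ hδ x)]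
  have hm : ∀ x : X, ∀ δ₁ δ₂ : ℝ, 0 < δ₁ → δ₁ ≤ δ₂ →
      (u x - uDelta u K δ₁ x) / δ₁ ≤ (u x - uDelta u K δ₂ x) / δ₂ := by
    intro x δ₁ δ₂ h1 h12
    have h2 : 0 < δ₂ := h1.trans_le h12
    obtain ⟨t, ht⟩ : ∃ t, t = δ₁ / δ₂ := ⟨_, rfl⟩
    have hd : δ₁ = t * δ₂ := by rw [ht]; field_simp
    have ht0 : 0 < t := by rw [ht]; positivity
    have ht1 : t ≤ 1 := by rw [ht, div_le_one h2]; exact h12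
    have key : (1 - t) * u x + t * uDelta u K δ₂ x ≤ uDelta u K δ₁ x := by
      apply hge
      intro y
      have e1 := mul_le_mul_of_nonneg_left (hl x y) (sub_nonneg.2 ht1)
      have e2 := mul_le_mul_of_nonneg_left (hle δ₂ h2 x y) ht0.le
      rw [hd]
      linarith
    rw [div_le_div_iff₀ h1 h2]
    generalize uDelta u K δ₁ x = a at *
    generalize uDelta u K δ₂ x = b at *
    rw [hd]
    nlinarith
  refine ⟨ha, hm, ?_⟩
  have hq : ∀ x, ∀ δ > 0, (u x - uDelta u K δ x) / δ ∈ Set.Icc (0:ℝ) 1 := by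
    intro x δ hδ
    obtain ⟨h1, h2⟩ := ha δ hδ x
    exact ⟨div_nonneg h1 hδ.le, (div_le_one hδ).2 h2⟩
  have hlim : ∀ x, ∃ l, Tendsto (fun δ => (u x - uDelta u K δ x) / δ)
      (nhdsWithin 0 (Set.Ioi 0)) (nhds l) := by
    intro x
    refine ⟨_, MonotoneOn.tendsto_nhdsGT (fun a ha b _ hab => hm x a b ha hab) ⟨0, ?_⟩⟩
    rintro _ ⟨δ, hδ, rfl⟩
    exact (hq x δ hδ).1
  choose L hL using hlim
  refine ⟨L, fun x => ⟨?_, hL x⟩, ?_, ?_⟩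
  · refine isClosed_Icc.mem_of_tendsto (hL x) ?_
    filter_upwards [self_mem_nhdsWithin] with δ hδ using hq x δ hδ
  · intro x hx
    have hpos : ∀ y ∈ K, 0 < u y + dist x y - u x := by
      intro y hy
      by_contra hcon
      have hxy : u x - u y = dist x y := by linarith [hl x y]
      obtain ⟨I, hSI, hI⟩ := exists_ray_aux u {x, y} (by
        have h3 : |u x - u y| = dist x y := by rw [hxy, abs_of_nonneg dist_nonneg]
        have h4 : |u y - u x| = dist y x := by rw [abs_sub_comm, dist_comm, h3]
        rintro a (rfl | rfl) b (rfl | rfl) <;> simp [h3, h4])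
      exact hx ⟨I, ⟨hI, y, hSI (by simp), hy⟩, hSI (by simp)⟩
    have hε : ∃ ε > 0, ∀ y ∈ K, ε ≤ u y + dist x y - u x := by
      rcases K.eq_empty_or_nonempty with rfl | hne
      · exact ⟨1, one_pos, by simp⟩
      · have hc := hu.continuous
        obtain ⟨y, hy, hmin⟩ := hK.exists_isMinOn hne
          (f := fun y => u y + dist x y - u x) (by fun_prop)
        exact ⟨_, hpos y hy, fun z hz => hmin hz⟩
    obtain ⟨ε, hε, hεK⟩ := hε
    refine tendsto_nhds_unique (hL x) (tendsto_const_nhds.congr' ?_)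
    filter_upwards [Ioo_mem_nhdsGT hε] with δ hδ
    have h1 : u x ≤ uDelta u K δ x := by
      apply hge
      intro y
      by_cases hy : y ∈ K
      · simp only [Set.indicator_of_mem hy]
        linarith [hεK y hy, hδ.2]
      · simp only [Set.indicator_of_notMem hy]
        linarith [hl x y]
    have h2 := (ha δ hδ.1 x).1
    have h3 : u x - uDelta u K δ x = 0 := by linarith
    rw [h3, zero_div]
  · intro x hx
    refine tendsto_nhds_unique (hL x) (tendsto_const_nhds.congr' ?_)
    filter_upwards [self_mem_nhdsWithin] with δ hδ
    have hδ' : 0 < δ := hδ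
    have h1 := hle δ hδ' x x
    rw [dist_self, Set.indicator_of_mem hx] at h1
    have h2 := (ha δ hδ' x).2
    have h3 : u x - uDelta u K δ x = δ := by linarith
    rw [h3, div_self hδ'.ne']
end

section
/- There exists a universal constant c > 0 with the following property. Let A ⊆ ℝ be a nonempty open interval, let Ψ : A → ℝ be a convex function with ∫_A e^{−Ψ(t)} dt < ∞, and let η be the measure on ℝ whose density with respect to Lebesgue measure is e^{−Ψ}·1_A. Let R = (∫_ℝ |t| dη(t)) / η(ℝ), and assume 0 < R < ∞. Then for every t ∈ (0,1), every ε with 0 < ε < 2R, and every Borel set S ⊆ ℝ with η(S) = t·η(ℝ), one has η(S_ε \ S) ≥ c·(ε/R)·t(1−t)·η(ℝ), where S_ε = { x ∈ ℝ : dist(x,S) < ε } is the open ε-neighborhood of S. -/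
open MeasureTheory

lemma needle_mul_mass_le (g : ℝ → ENNReal) (hg : Measurable g)
    (hlc : ∀ x s u : ℝ, x ≤ s → 0 ≤ u → g x * g (s + u) ≤ g s * g (x + u))
    (x s : ℝ) :
    g x * ((volume.withDensity g) (Set.Iio s) * (volume.withDensity g) (Set.Ioi s))
      ≤ g s * ((volume.withDensity g) Set.univ * (volume.withDensity g) Set.univ) := by
  set η := volume.withDensity g with hη
  have hM : η Set.univ = ∫⁻ y, g y := by
    rw [hη, withDensity_apply _ MeasurableSet.univ, Measure.restrict_univ]
  rcases le_total x s with h | h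
  · have h1 : g x * η (Set.Ioi s) ≤ g s * η Set.univ := by
      rw [hM, hη, withDensity_apply _ measurableSet_Ioi, ← lintegral_const_mul _ hg]
      calc ∫⁻ y in Set.Ioi s, g x * g y ≤ ∫⁻ y in Set.Ioi s, g s * g (y + (x - s)) := by
            apply setLIntegral_mono' measurableSet_Ioi
            intro y hy
            have hy' : s < y := hy
            have := hlc x s (y - s) h (by linarith)
            rw [show s + (y - s) = y by ring, show x + (y - s) = y + (x - s) by ring] at this
            exact this
        _ ≤ ∫⁻ y, g s * g (y + (x - s)) := setLIntegral_le_lintegral _ _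
        _ = ∫⁻ y, g s * g y := lintegral_add_right_eq_self (fun y => g s * g y) (x - s)
        _ = g s * ∫⁻ y, g y := lintegral_const_mul _ hg
    calc g x * (η (Set.Iio s) * η (Set.Ioi s)) = η (Set.Iio s) * (g x * η (Set.Ioi s)) := by ring
      _ ≤ η Set.univ * (g s * η Set.univ) := by
          gcongr
          exact Set.subset_univ _
      _ = _ := by ring
  · have h1 : g x * η (Set.Iio s) ≤ g s * η Set.univ := by
      rw [hM, hη, withDensity_apply _ measurableSet_Iio, ← lintegral_const_mul _ hg]
      calc ∫⁻ y in Set.Iio s, g x * g y ≤ ∫⁻ y in Set.Iio s, g s * g (y + (x - s)) := by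
            apply setLIntegral_mono' measurableSet_Iio
            intro y hy
            have hy' : y < s := hy
            have := hlc y (y + (x - s)) (s - y) (by linarith) (by linarith)
            rw [show y + (x - s) + (s - y) = x by ring, show y + (s - y) = s by ring] at this
            rw [mul_comm (g x), mul_comm (g s)]
            exact this
        _ ≤ ∫⁻ y, g s * g (y + (x - s)) := setLIntegral_le_lintegral _ _
        _ = ∫⁻ y, g s * g y := lintegral_add_right_eq_self (fun y => g s * g y) (x - s)
        _ = g s * ∫⁻ y, g y := lintegral_const_mul _ hg
    calc g x * (η (Set.Iio s) * η (Set.Ioi s)) = η (Set.Ioi s) * (g x * η (Set.Iio s)) := by ring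
      _ ≤ η Set.univ * (g s * η Set.univ) := by
          gcongr
          exact Set.subset_univ _
      _ = _ := by ring

/-- the separating gap -/
lemma needle_gap (S : Set ℝ) (ε : ℝ) (hε : 0 < ε) (x y : ℝ) (hx : x ∈ S)
    (hy : y ∉ Metric.thickening ε S) :
    ∃ a : ℝ, Set.Ioo a (a + ε) ⊆ (Metric.thickening ε S \ S) ∩
      {s | (x < s ∧ s < y) ∨ (s < x ∧ y < s)} := by
  have hfar : ∀ z ∈ S, ε ≤ |y - z| := by
    intro z hz
    by_contra hlt
    exact hy (Metric.mem_thickening_iff.2 ⟨z, hz, by rw [Real.dist_eq]; linarith⟩)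
  rcases le_total x y with hxy | hxy
  · set B := S ∩ Set.Icc x y with hB
    have hne : B.Nonempty := ⟨x, hx, le_refl _, hxy⟩
    have hbd : BddAbove B := ⟨y, fun z hz => hz.2.2⟩
    have h1 : ∀ z ∈ B, z ≤ y - ε := by
      intro z hz
      have := hfar z hz.1
      rw [abs_of_nonneg (by linarith [hz.2.2])] at this
      linarith
    have h2 : sSup B ≤ y - ε := csSup_le hne h1
    have h3 : x ≤ sSup B := le_csSup hbd ⟨hx, le_refl _, hxy⟩
    refine ⟨sSup B, fun s hs => ?_⟩
    obtain ⟨hs1, hs2⟩ := hs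
    refine ⟨⟨?_, ?_⟩, Or.inl ⟨by linarith, by linarith⟩⟩
    · obtain ⟨z, hz, hz'⟩ := exists_lt_of_lt_csSup hne (show s - ε < sSup B by linarith)
      have hz2 := le_csSup hbd hz
      refine Metric.mem_thickening_iff.2 ⟨z, hz.1, ?_⟩
      rw [Real.dist_eq, abs_lt]
      constructor <;> linarith
    · intro hsS
      have := le_csSup hbd (show s ∈ B from ⟨hsS, by linarith, by linarith⟩)
      linarith
  · set B := S ∩ Set.Icc y x with hB
    have hne : B.Nonempty := ⟨x, hx, hxy, le_refl _⟩
    have hbd : BddBelow B := ⟨y, fun z hz => hz.2.1⟩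
    have h1 : ∀ z ∈ B, y + ε ≤ z := by
      intro z hz
      have := hfar z hz.1
      rw [abs_of_nonpos (by linarith [hz.2.1])] at this
      linarith
    have h2 : y + ε ≤ sInf B := le_csInf hne h1
    have h3 : sInf B ≤ x := csInf_le hbd ⟨hx, hxy, le_refl _⟩
    refine ⟨sInf B - ε, fun s hs => ?_⟩
    obtain ⟨hs1, hs2⟩ := hs
    refine ⟨⟨?_, ?_⟩, Or.inr ⟨by linarith, by linarith⟩⟩
    · obtain ⟨z, hz, hz'⟩ := exists_lt_of_csInf_lt hne (show sInf B < s + ε by linarith)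
      have hz2 := csInf_le hbd hz
      refine Metric.mem_thickening_iff.2 ⟨z, hz.1, ?_⟩
      rw [Real.dist_eq, abs_lt]
      constructor <;> linarith
    · intro hsS
      have := csInf_le hbd (show s ∈ B from ⟨hsS, by linarith, by linarith⟩)
      linarith

lemma needle_double_count (η : Measure ℝ) [IsFiniteMeasure η] (S : Set ℝ) (hS : MeasurableSet S)
    (ε : ℝ) (hε : 0 < ε) :
    ENNReal.ofReal ε * (η S * η (Metric.thickening ε S)ᶜ) ≤
      ∫⁻ s in (Metric.thickening ε S \ S), 2 * (η (Set.Iio s) * η (Set.Ioi s)) := by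
  set D := Metric.thickening ε S \ S with hD
  have hDm : MeasurableSet D := Metric.isOpen_thickening.measurableSet.diff hS
  have hTm : MeasurableSet (Metric.thickening ε S)ᶜ := Metric.isOpen_thickening.measurableSet.compl
  set W : Set ((ℝ × ℝ) × ℝ) :=
    {q | q.2 ∈ D} ∩ ({q | q.1.1 < q.2 ∧ q.2 < q.1.2} ∪ {q | q.2 < q.1.1 ∧ q.1.2 < q.2}) with hW
  have hWm : MeasurableSet W := by
    have m1 : Measurable (fun q : (ℝ × ℝ) × ℝ => q.1.1) := by fun_prop
    have m2 : Measurable (fun q : (ℝ × ℝ) × ℝ => q.1.2) := by fun_prop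
    have m3 : Measurable (fun q : (ℝ × ℝ) × ℝ => q.2) := by fun_prop
    exact (m3 hDm).inter (((measurableSet_lt m1 m3).inter (measurableSet_lt m3 m2)).union
      ((measurableSet_lt m3 m1).inter (measurableSet_lt m2 m3)))
  calc ENNReal.ofReal ε * (η S * η (Metric.thickening ε S)ᶜ)
      = ∫⁻ p in S ×ˢ (Metric.thickening ε S)ᶜ, ENNReal.ofReal ε ∂(η.prod η) := by
        rw [setLIntegral_const, Measure.prod_prod]
    _ ≤ ∫⁻ p in S ×ˢ (Metric.thickening ε S)ᶜ, volume (Prod.mk p ⁻¹' W) ∂(η.prod η) := by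
        apply setLIntegral_mono' (hS.prod hTm)
        rintro ⟨x, y⟩ ⟨hx, hy⟩
        obtain ⟨a, ha⟩ := needle_gap S ε hε x y hx hy
        calc ENNReal.ofReal ε = volume (Set.Ioo a (a + ε)) := by
              rw [Real.volume_Ioo]; congr 1; ring
          _ ≤ volume (Prod.mk (x, y) ⁻¹' W) := measure_mono (fun s hs => ⟨(ha hs).1, (ha hs).2⟩)
    _ ≤ ∫⁻ p, volume (Prod.mk p ⁻¹' W) ∂(η.prod η) := setLIntegral_le_lintegral _ _
    _ = ((η.prod η).prod volume) W := (Measure.prod_apply hWm).symm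
    _ = ∫⁻ s, (η.prod η) ((fun p => (p, s)) ⁻¹' W) := Measure.prod_apply_symm hWm
    _ ≤ ∫⁻ s, D.indicator (fun s => 2 * (η (Set.Iio s) * η (Set.Ioi s))) s := by
        apply lintegral_mono
        intro s
        by_cases hs : s ∈ D
        · simp only [Set.indicator_of_mem hs]
          calc (η.prod η) ((fun p => (p, s)) ⁻¹' W)
              ≤ (η.prod η) ((Set.Iio s ×ˢ Set.Ioi s) ∪ (Set.Ioi s ×ˢ Set.Iio s)) := by
                apply measure_mono
                rintro ⟨x, y⟩ ⟨_, h | h⟩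
                · exact Or.inl ⟨h.1, h.2⟩
                · exact Or.inr ⟨h.1, h.2⟩
            _ ≤ _ := measure_union_le _ _
            _ = _ := by rw [Measure.prod_prod, Measure.prod_prod]; ring
        · have : ((fun p : ℝ × ℝ => (p, s)) ⁻¹' W) = ∅ := by
            ext p
            simp only [Set.mem_preimage, Set.mem_empty_iff_false, iff_false]
            exact fun h => hs h.1
          simp only [this, measure_empty, zero_le]
    _ = _ := lintegral_indicator hDm _

lemma needle_lc (A : Set ℝ) (hA : A.OrdConnected) (Ψ : ℝ → ℝ) (hΨ : ConvexOn ℝ A Ψ)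
    (x s u : ℝ) (hxs : x ≤ s) (hu : 0 ≤ u) :
    A.indicator (fun t => ENNReal.ofReal (Real.exp (-Ψ t))) x *
      A.indicator (fun t => ENNReal.ofReal (Real.exp (-Ψ t))) (s + u) ≤
    A.indicator (fun t => ENNReal.ofReal (Real.exp (-Ψ t))) s *
      A.indicator (fun t => ENNReal.ofReal (Real.exp (-Ψ t))) (x + u) := by
  by_cases hx : x ∈ A
  swap
  · simp [hx]
  by_cases hy : s + u ∈ A
  swap
  · simp [hy]
  have hs : s ∈ A := hA.out hx hy ⟨hxs, by linarith⟩
  have hxu : x + u ∈ A := hA.out hx hy ⟨by linarith, by linarith⟩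
  simp only [Set.indicator_of_mem, hx, hy, hs, hxu]
  rw [← ENNReal.ofReal_mul (Real.exp_pos _).le, ← ENNReal.ofReal_mul (Real.exp_pos _).le,
    ← Real.exp_add, ← Real.exp_add]
  apply ENNReal.ofReal_le_ofReal
  apply Real.exp_le_exp.2
  suffices Ψ s + Ψ (x + u) ≤ Ψ x + Ψ (s + u) by linarith
  rcases eq_or_lt_of_le (show x ≤ s + u by linarith) with h | h
  · have h1 : s = x := by linarith
    have h2 : u = 0 := by linarith
    subst h1 h2
    simp
  · have hd : 0 < s + u - x := by linarith
    have hconv : ∀ a b : ℝ, 0 ≤ a → 0 ≤ b → a + b = 1 →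
        Ψ (a • x + b • (s + u)) ≤ a • Ψ x + b • Ψ (s + u) := fun a b ha hb hab =>
      hΨ.2 hx hy ha hb hab
    have c1 := hconv (u / (s + u - x)) ((s - x) / (s + u - x))
      (by positivity) (div_nonneg (by linarith) hd.le) (by field_simp; ring)
    have c2 := hconv ((s - x) / (s + u - x)) (u / (s + u - x))
      (div_nonneg (by linarith) hd.le) (by positivity) (by field_simp; ring)
    simp only [smul_eq_mul] at c1 c2
    rw [show u / (s + u - x) * x + (s - x) / (s + u - x) * (s + u) = s by field_simp; ring] at c1
    rw [show (s - x) / (s + u - x) * x + u / (s + u - x) * (s + u) = x + u by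
      field_simp; ring] at c2
    have e : u / (s + u - x) + (s - x) / (s + u - x) = 1 := by field_simp; ring
    have e' : (s - x) / (s + u - x) = 1 - u / (s + u - x) := by linarith
    rw [e'] at c1 c2
    linarith


/-- One-dimensional estimate for log-concave needles: there is a universal constant `c > 0`
such that for every measure `η` on `ℝ` with density `e^{-Ψ}` on a nonempty open interval `A`
(`Ψ` convex, `e^{-Ψ}` integrable on `A`), with normalized first absolute moment
`R = (∫ |t| dη)/η(ℝ) ∈ (0,∞)`, every set `S` of relative measure `t ∈ (0,1)` and every
`0 < ε < 2R` satisfy `η(S_ε \ S) ≥ c (ε/R) t (1-t) η(ℝ)`. -/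
theorem logconcave_needle_thickening :
    ∃ c : ℝ, 0 < c ∧
      ∀ A : Set ℝ, A.Nonempty → IsOpen A → A.OrdConnected →
      ∀ Ψ : ℝ → ℝ, ConvexOn ℝ A Ψ →
      IntegrableOn (fun t => Real.exp (-Ψ t)) A volume →
      ∀ η : Measure ℝ,
        η = (volume.restrict A).withDensity (fun t => ENNReal.ofReal (Real.exp (-Ψ t))) →
      Integrable (fun t : ℝ => |t|) η →
      ∀ R : ℝ, R = (∫ t, |t| ∂η) / (η Set.univ).toReal → 0 < R →
      ∀ t : ℝ, t ∈ Set.Ioo (0 : ℝ) 1 →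
      ∀ ε : ℝ, 0 < ε → ε < 2 * R →
      ∀ S : Set ℝ, MeasurableSet S → η S = ENNReal.ofReal t * η Set.univ →
        ENNReal.ofReal (c * (ε / R) * (t * (1 - t))) * η Set.univ ≤
          η (Metric.thickening ε S \ S) := by
  refine ⟨1 / 32, by norm_num, ?_⟩
  intro A hAne hAo hA Ψ hΨ hint η hη habs R hR hR0 t ht ε hε hεR S hS hSt
  set g : ℝ → ENNReal := A.indicator (fun t => ENNReal.ofReal (Real.exp (-Ψ t))) with hgdef
  have hAm := hAo.measurableSet
  have hcont : ContinuousOn Ψ A := hΨ.continuousOn hAo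
  have hg : Measurable g := by
    have hc : ContinuousOn (fun t => ENNReal.ofReal (Real.exp (-Ψ t))) A :=
      ENNReal.continuous_ofReal.comp_continuousOn (Real.continuous_exp.comp_continuousOn hcont.neg)
    classical
    rw [hgdef, ← Set.piecewise_eq_indicator]
    exact hc.measurable_piecewise continuousOn_const hAm
  have hηg : η = volume.withDensity g := by
    rw [hη, hgdef, withDensity_indicator hAm]
  have hlc := needle_lc A hA Ψ hΨ
  have hfin : IsFiniteMeasure η := by
    rw [hη]
    exact isFiniteMeasure_withDensity_ofReal hint.2
  set D := Metric.thickening ε S \ S with hD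
  have hDm : MeasurableSet D := Metric.isOpen_thickening.measurableSet.diff hS
  have hTm : MeasurableSet (Metric.thickening ε S)ᶜ := Metric.isOpen_thickening.measurableSet.compl
  -- Markov
  set M := η.real Set.univ with hM
  have hMM : (η Set.univ).toReal = M := rfl
  rw [hMM] at hR
  have hMpos : 0 < M := by
    rcases eq_or_lt_of_le (show 0 ≤ M from measureReal_nonneg) with h | h
    · rw [← h] at hR; simp at hR; linarith
    · exact h
  have hRM : ∫ t, |t| ∂η = R * M := by rw [hR]; field_simp
  set I := Set.Ioo (-(2 * R)) (2 * R) with hI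
  have hIM : M ≤ 2 * η.real I := by
    have h1 := mul_meas_ge_le_integral_of_nonneg (μ := η) (f := fun t : ℝ => |t|)
      (Filter.Eventually.of_forall fun t => abs_nonneg t) habs (2 * R)
    rw [hRM] at h1
    have h2 : {x : ℝ | 2 * R ≤ |x|} = Iᶜ := by
      ext x
      simp only [hI, Set.mem_ofPred_eq, Set.mem_compl_iff, Set.mem_Ioo, ← abs_lt, not_lt]
    rw [h2] at h1
    have h3 : η.real I + η.real Iᶜ = M := measureReal_add_measureReal_compl measurableSet_Ioo
    have h1' : 2 * R * η.real Iᶜ ≤ R * M := h1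
    have : 2 * η.real Iᶜ ≤ M := by
      by_contra hc
      push Not at hc
      nlinarith
    linarith
  -- pointwise bound
  have hpt : ∀ s, η I * (η (Set.Iio s) * η (Set.Ioi s)) ≤
      ENNReal.ofReal (4 * R) * (g s * (η Set.univ * η Set.univ)) := by
    intro s
    have h1 : η I = ∫⁻ x in I, g x := by rw [hηg, withDensity_apply _ measurableSet_Ioo]
    calc η I * (η (Set.Iio s) * η (Set.Ioi s))
        = ∫⁻ x in I, g x * (η (Set.Iio s) * η (Set.Ioi s)) := by
          rw [h1, lintegral_mul_const _ hg]
      _ ≤ ∫⁻ x in I, g s * (η Set.univ * η Set.univ) := by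
          apply lintegral_mono
          intro x
          rw [hηg]
          exact needle_mul_mass_le g hg hlc x s
      _ = _ := by
          rw [setLIntegral_const, hI, Real.volume_Ioo, mul_comm]
          congr 2; ring
  have hdc := needle_double_count η S hS ε hε
  have hFm : Measurable (fun s => η (Set.Iio s)) :=
    Monotone.measurable fun a b h => measure_mono (Set.Iio_subset_Iio h)
  have hGm : Measurable (fun s => η (Set.Ioi s)) :=
    Antitone.measurable fun a b h => measure_mono (Set.Ioi_subset_Ioi h)
  have key : η I * (ENNReal.ofReal ε * (η S * η (Metric.thickening ε S)ᶜ)) ≤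
      ENNReal.ofReal (8 * R) * (η Set.univ * η Set.univ) * η D := by
    calc _ ≤ η I * ∫⁻ s in D, 2 * (η (Set.Iio s) * η (Set.Ioi s)) := by gcongr
      _ = ∫⁻ s in D, η I * (2 * (η (Set.Iio s) * η (Set.Ioi s))) := by
          exact (lintegral_const_mul (η I) ((hFm.mul hGm).const_mul 2)).symm
      _ ≤ ∫⁻ s in D, ENNReal.ofReal (8 * R) * (η Set.univ * η Set.univ) * g s := by
          apply lintegral_mono
          intro s
          have h8 : ENNReal.ofReal (8 * R) = 2 * ENNReal.ofReal (4 * R) := by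
            rw [show 8 * R = 2 * (4 * R) by ring, ENNReal.ofReal_mul (by norm_num)]
            simp
          calc η I * (2 * (η (Set.Iio s) * η (Set.Ioi s)))
              = 2 * (η I * (η (Set.Iio s) * η (Set.Ioi s))) := by ring
            _ ≤ 2 * (ENNReal.ofReal (4 * R) * (g s * (η Set.univ * η Set.univ))) := by
                exact mul_le_mul_right (hpt s) 2
            _ = _ := by rw [h8]; ring
      _ = _ := by
          rw [lintegral_const_mul _ hg]
          congr 1
          rw [hηg, withDensity_apply _ hDm]
  have keyR : η.real I * (ε * (η.real S * η.real (Metric.thickening ε S)ᶜ)) ≤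
      8 * R * (M * M) * η.real D := by
    have := ENNReal.toReal_mono (by finiteness) key
    simpa only [ENNReal.toReal_mul, ENNReal.toReal_ofReal hε.le,
      ENNReal.toReal_ofReal (show 0 ≤ 8 * R by linarith), measureReal_def, hM] using this
  have hSr : η.real S = t * M := by
    rw [measureReal_def, hSt, ENNReal.toReal_mul, ENNReal.toReal_ofReal ht.1.le, hMM]
  have hsum : η.real S + η.real D + η.real (Metric.thickening ε S)ᶜ = M := by
    have h1 : η.real (Metric.thickening ε S) + η.real (Metric.thickening ε S)ᶜ = M :=
      measureReal_add_measureReal_compl Metric.isOpen_thickening.measurableSet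
    have h2 : η.real D = η.real (Metric.thickening ε S) - η.real S :=
      measureReal_sdiff (Metric.self_subset_thickening hε S) hS
    linarith
  have hfinal : 1 / 32 * (ε / R) * (t * (1 - t)) * M ≤ η.real D := by
    obtain ⟨ht0, ht1⟩ := ht
    have hq : ε / R ≤ 2 := by rw [div_le_iff₀ hR0]; linarith
    have hq0 : 0 < ε / R := by positivity
    set q := ε / R with hqd
    have hεq : ε = q * R := by rw [hqd]; field_simp
    set d := η.real D
    set w := η.real (Metric.thickening ε S)ᶜ
    have hw0 : 0 ≤ w := measureReal_nonneg
    rcases le_total ((1 - t) * M / 2) d with h | h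
    · refine le_trans ?_ h
      have : q * t ≤ 2 * 1 := by gcongr
      have h2 : 0 ≤ (1 - t) * M := mul_nonneg (by linarith) hMpos.le
      nlinarith
    · have hw : (1 - t) * M / 2 ≤ w := by nlinarith
      rw [hSr, hεq] at keyR
      have h1 : M / 2 * (q * R * (t * M * ((1 - t) * M / 2))) ≤ 8 * R * (M * M) * d := by
        refine le_trans ?_ keyR
        have : 0 ≤ t * M := by positivity
        have : 0 ≤ (1 - t) * M / 2 := by
          have := mul_nonneg (show 0 ≤ 1 - t by linarith) hMpos.le
          linarith
        gcongr
        linarith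
      have h2 : (R * (M * M) * 8) * (1 / 32 * q * (t * (1 - t)) * M) ≤ (R * (M * M) * 8) * d := by
        linarith
      exact le_of_mul_le_mul_left h2 (by positivity)
  have hun : η Set.univ = ENNReal.ofReal M := by rw [hM, ofReal_measureReal]
  rw [hun, ← ENNReal.ofReal_mul' hMpos.le, ← ofReal_measureReal (μ := η) (s := D)]
  exact ENNReal.ofReal_le_ofReal hfinal
end

section
/- Let (M,d) be a σ-compact metric space and let u : M → ℝ be 1-Lipschitz. For ε > 0 let Strain_ε[u] be the set of all y ∈ M for which there exist x, z ∈ M with u(y) − u(x) = d(x,y) > ε, u(z) − u(y) = d(y,z) > ε, and d(x,z) = d(x,y) + d(y,z). Then each Strain_ε[u] is a countable union of compact sets (in particular Borel), and hence the strain set Strain[u] = ⋃_{ε>0} Strain_ε[u] is a Borel subset of M. -/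
/-- The set `Strain_ε[u]` of `ε`-strain points of `u`: points `y` admitting witnesses `x, z`
with `u(y) - u(x) = d(x,y) > ε`, `u(z) - u(y) = d(y,z) > ε` and
`d(x,z) = d(x,y) + d(y,z)`. -/
def strainEps {X : Type*} [MetricSpace X] (u : X → ℝ) (ε : ℝ) : Set X :=
  {y | ∃ x z : X, u y - u x = dist x y ∧ ε < dist x y ∧
    u z - u y = dist y z ∧ ε < dist y z ∧ dist x z = dist x y + dist y z}

theorem strainEps_isSigmaCompact_aux {X : Type*} [MetricSpace X] [SigmaCompactSpace X]
    (u : X → ℝ) (hu : LipschitzWith 1 u) (ε : ℝ) : IsSigmaCompact (strainEps u ε) := by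
  have hc := hu.continuous
  let F : ℕ → Set (X × X × X) := fun n => {p | u p.2.1 - u p.1 = dist p.1 p.2.1 ∧
    ε + 1 / ((n : ℝ) + 1) ≤ dist p.1 p.2.1 ∧ u p.2.2 - u p.2.1 = dist p.2.1 p.2.2 ∧
    ε + 1 / ((n : ℝ) + 1) ≤ dist p.2.1 p.2.2 ∧
    dist p.1 p.2.2 = dist p.1 p.2.1 + dist p.2.1 p.2.2}
  have hF : ∀ n, IsClosed (F n) := by
    intro n
    have h0 : IsClosed {p : X × X × X | u p.2.1 - u p.1 = dist p.1 p.2.1} :=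
      isClosed_eq (by fun_prop) (by fun_prop)
    have h1 : IsClosed {p : X × X × X | ε + 1 / ((n : ℝ) + 1) ≤ dist p.1 p.2.1} :=
      isClosed_le (by fun_prop) (by fun_prop)
    have h2 : IsClosed {p : X × X × X | u p.2.2 - u p.2.1 = dist p.2.1 p.2.2} :=
      isClosed_eq (by fun_prop) (by fun_prop)
    have h3 : IsClosed {p : X × X × X | ε + 1 / ((n : ℝ) + 1) ≤ dist p.2.1 p.2.2} :=
      isClosed_le (by fun_prop) (by fun_prop)
    have h4 : IsClosed {p : X × X × X | dist p.1 p.2.2 = dist p.1 p.2.1 + dist p.2.1 p.2.2} :=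
      isClosed_eq (by fun_prop) (by fun_prop)
    exact h0.inter (h1.inter (h2.inter (h3.inter h4)))
  have key : strainEps u ε = ⋃ n, (fun p : X × X × X => p.2.1) '' F n := by
    ext y
    simp only [Set.mem_iUnion, Set.mem_image]
    constructor
    · rintro ⟨x, z, h1, h2, h3, h4, h5⟩
      obtain ⟨n, hn⟩ := exists_nat_one_div_lt
        (lt_min (sub_pos.2 h2) (sub_pos.2 h4))
      have ha := hn.trans_le (min_le_left _ _)
      have hb := hn.trans_le (min_le_right _ _)
      exact ⟨n, (x, y, z), ⟨h1, by dsimp only; linarith, h3, by dsimp only; linarith, h5⟩, rfl⟩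
    · rintro ⟨n, ⟨x, y', z⟩, ⟨h1, h2, h3, h4, h5⟩, rfl⟩
      have hp : (0 : ℝ) < 1 / ((n : ℝ) + 1) := by positivity
      dsimp only at *
      exact ⟨x, z, h1, by linarith, h3, by linarith, h5⟩
  rw [key]
  refine isSigmaCompact_iUnion _ fun n => ?_
  exact (isSigmaCompact_univ.of_isClosed_subset (hF n) (Set.subset_univ _)).image (by fun_prop)

/-- In a σ-compact metric space, each set `Strain_ε[u]` is σ-compact (a countable union of
compact sets), and hence the strain set `Strain[u] = ⋃_{ε > 0} Strain_ε[u]` is Borel. -/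
theorem strainEps_sigmaCompact {X : Type*} [MetricSpace X] [SigmaCompactSpace X]
    [MeasurableSpace X] [BorelSpace X] (u : X → ℝ) (hu : LipschitzWith 1 u) :
    (∀ ε > (0 : ℝ), ∃ C : ℕ → Set X, (∀ i, IsCompact (C i)) ∧ strainEps u ε = ⋃ i, C i) ∧
    MeasurableSet (⋃ ε ∈ Set.Ioi (0 : ℝ), strainEps u ε) := by
  refine ⟨fun ε _ => ?_, ?_⟩
  · obtain ⟨C, hC, h⟩ := strainEps_isSigmaCompact_aux u hu ε
    exact ⟨C, hC, h.symm⟩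
  · have h0 : (⋃ ε ∈ Set.Ioi (0 : ℝ), strainEps u ε) = strainEps u 0 := by
      ext y
      simp only [Set.mem_iUnion, Set.mem_Ioi]
      constructor
      · rintro ⟨ε, hε, x, z, h1, h2, h3, h4, h5⟩
        exact ⟨x, z, h1, hε.trans h2, h3, hε.trans h4, h5⟩
      · rintro ⟨x, z, h1, h2, h3, h4, h5⟩
        obtain ⟨ε, hε, hlt⟩ := exists_between (lt_min h2 h4)
        exact ⟨ε, hε, x, z, h1, hlt.trans_le (min_le_left _ _), h3,
          hlt.trans_le (min_le_right _ _), h5⟩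
    rw [h0]
    obtain ⟨C, hC, h⟩ := strainEps_isSigmaCompact_aux u hu 0
    rw [← h]
    exact MeasurableSet.iUnion fun i => (hC i).measurableSet
end

section
/- Let x₀, x₁, x₂, y₀, y₁, y₂ ∈ ℝⁿ and σ > 0 satisfy ‖x_i − x_j‖ = ‖y_i − y_j‖ = σ|i − j| ≤ ‖x_i − y_j‖ for all i,j ∈ {0,1,2}. Then max{‖x₀ − y₀‖, ‖x₂ − y₂‖} ≤ 10·‖x₁ − y₁‖. (Euclidean case of the Feldman–McCann six-point lemma.) -/
theorem fm_mid {E : Type*} [NormedAddCommGroup E] [InnerProductSpace ℝ E] (a b c : E) (σ : ℝ)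
    (h1 : ‖a - b‖ = σ) (h2 : ‖b - c‖ = σ) (h3 : ‖a - c‖ = 2 * σ) : a - b = b - c := by
  have h := parallelogram_law_with_norm ℝ (a - b) (b - c)
  have e : (a - b) + (b - c) = a - c := by abel
  rw [e, h1, h2, h3] at h
  have : ‖(a - b) - (b - c)‖ = 0 := by
    have : ‖(a - b) - (b - c)‖ * ‖(a - b) - (b - c)‖ = 0 := by linarith
    exact mul_self_eq_zero.mp this
  exact sub_eq_zero.mp (norm_eq_zero.mp this)

theorem fm_key {E : Type*} [NormedAddCommGroup E] [InnerProductSpace ℝ E] (u v d : E) (σ : ℝ)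
    (hσ : 0 < σ) (hu : ‖u‖ = σ) (hv : ‖v‖ = σ) (h1 : 2 * σ ≤ ‖(u + v) + d‖)
    (h2 : 2 * σ ≤ ‖(u + v) - d‖) : ‖u - v‖ ≤ ‖d‖ := by
  have p := parallelogram_law_with_norm ℝ (u + v) d
  have q := parallelogram_law_with_norm ℝ u v
  rw [hu, hv] at q
  have a1 := mul_self_le_mul_self (by positivity) h1
  have a2 := mul_self_le_mul_self (by positivity) h2
  refine (sq_le_sq₀ (norm_nonneg _) (norm_nonneg _)).mp ?_
  nlinarith



/-- **Feldman–McCann six-point lemma, Euclidean case**: if `x₀,x₁,x₂` and `y₀,y₁,y₂` are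
equally spaced triples with spacing `σ` and `‖xᵢ - yⱼ‖ ≥ σ|i-j|` for all `i,j ∈ {0,1,2}`,
then `max(‖x₀ - y₀‖, ‖x₂ - y₂‖) ≤ 10 ‖x₁ - y₁‖`. -/
theorem feldman_mccann_six_points {n : ℕ} (x y : Fin 3 → EuclideanSpace ℝ (Fin n))
    (σ : ℝ) (hσ : 0 < σ)
    (hx : ∀ i j : Fin 3, ‖x i - x j‖ = σ * |(i : ℝ) - (j : ℝ)|)
    (hy : ∀ i j : Fin 3, ‖y i - y j‖ = σ * |(i : ℝ) - (j : ℝ)|)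
    (hxy : ∀ i j : Fin 3, σ * |(i : ℝ) - (j : ℝ)| ≤ ‖x i - y j‖) :
    max ‖x 0 - y 0‖ ‖x 2 - y 2‖ ≤ 10 * ‖x 1 - y 1‖ := by
  have x01 : ‖x 0 - x 1‖ = σ := by simpa using hx 0 1
  have x12 : ‖x 1 - x 2‖ = σ := by rw [hx 1 2]; norm_num
  have x02 : ‖x 0 - x 2‖ = 2 * σ := by rw [hx 0 2]; norm_num; ring
  have y01 : ‖y 0 - y 1‖ = σ := by simpa using hy 0 1
  have y12 : ‖y 1 - y 2‖ = σ := by rw [hy 1 2]; norm_num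
  have y02 : ‖y 0 - y 2‖ = 2 * σ := by rw [hy 0 2]; norm_num; ring
  have c1 : 2 * σ ≤ ‖x 0 - y 2‖ := by
    refine le_trans (le_of_eq ?_) (hxy 0 2); norm_num; ring
  have c2 : 2 * σ ≤ ‖x 2 - y 0‖ := by
    refine le_trans (le_of_eq ?_) (hxy 2 0); norm_num; ring
  have mx := fm_mid _ _ _ σ x01 x12 x02
  have my := fm_mid _ _ _ σ y01 y12 y02
  have k := fm_key (x 0 - x 1) (y 0 - y 1) (x 1 - y 1) σ hσ x01 y01
    (by
      have e : x 0 - x 1 + (y 0 - y 1) + (x 1 - y 1) = x 0 - y 2 := by rw [my]; abel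
      rwa [e])
    (by
      have e : x 0 - x 1 + (y 0 - y 1) - (x 1 - y 1) = -(x 2 - y 0) := by rw [mx]; abel
      rwa [e, norm_neg])
  have e0 : x 0 - y 0 = (x 0 - x 1 - (y 0 - y 1)) + (x 1 - y 1) := by abel
  have e2 : x 2 - y 2 = (x 1 - y 1) - (x 0 - x 1 - (y 0 - y 1)) := by rw [mx, my]; abel
  have n0 := norm_nonneg (x 1 - y 1)
  apply max_le
  · rw [e0]
    have := norm_add_le (x 0 - x 1 - (y 0 - y 1)) (x 1 - y 1)
    linarith
  · rw [e2]
    have := norm_sub_le (x 1 - y 1) (x 0 - x 1 - (y 0 - y 1))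
    linarith
end

section
/- Let n ≥ 2, let Ω ⊆ ℝⁿ be a nonempty open convex set, let ρ : Ω → ℝ be smooth, and let μ be the measure on Ω with density e^{−ρ} with respect to Lebesgue measure. Let f : Ω → ℝ be μ-integrable with ∫_Ω f dμ = 0, and suppose there exists x₀ ∈ Ω with ∫_Ω |f(x)|·‖x−x₀‖ dμ(x) < ∞. Let u : Ω → ℝ be 1-Lipschitz with ∫_Ω u f dμ = sup{ ∫_Ω v f dμ : v : Ω → ℝ 1-Lipschitz }. Then f(x) = 0 for μ-almost every x ∈ Ω \ Strain[u]. -/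
open MeasureTheory

/-- The strain set of `u` relative to `Ω ⊆ ℝⁿ`: points `y ∈ Ω` admitting witnesses
`x, z ∈ Ω` with `u(y) - u(x) = ‖x-y‖ > 0`, `u(z) - u(y) = ‖y-z‖ > 0` and
`‖x-z‖ = ‖x-y‖ + ‖y-z‖`. -/
def strainOn {n : ℕ} (u : EuclideanSpace ℝ (Fin n) → ℝ)
    (Ω : Set (EuclideanSpace ℝ (Fin n))) : Set (EuclideanSpace ℝ (Fin n)) :=
  {y ∈ Ω | ∃ x ∈ Ω, ∃ z ∈ Ω, u y - u x = ‖x - y‖ ∧ 0 < ‖x - y‖ ∧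
    u z - u y = ‖y - z‖ ∧ 0 < ‖y - z‖ ∧ ‖x - z‖ = ‖x - y‖ + ‖y - z‖}

section Aux

open MeasureTheory Set Filter Topology
set_option linter.unusedSectionVars false

variable {E : Type*} [NormedAddCommGroup E] [InnerProductSpace ℝ E]

/-- no point of `Ω` below `y` on a transport ray -/
def lowEnd (u : E → ℝ) (Ω : Set E) : Set E :=
  {y | ∀ x ∈ Ω, x ≠ y → u y - u x < ‖x - y‖}

/-- points that extend backwards by at least `c` -/
def backSet (u : E → ℝ) (Ω : Set E) (c : ℝ) : Set E :=
  {p | ∃ x ∈ Ω, u p - u x = ‖x - p‖ ∧ c ≤ ‖x - p‖}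

lemma lip_le {u : E → ℝ} (hu : LipschitzWith 1 u) (x y : E) : u x - u y ≤ ‖x - y‖ := by
  have h := hu.dist_le_mul x y
  rw [Real.dist_eq, dist_eq_norm] at h
  have := le_abs_self (u x - u y)
  simp at h
  linarith

lemma lip_of {u : E → ℝ} (h : ∀ x y, u x - u y ≤ ‖x - y‖) : LipschitzWith 1 u := by
  refine LipschitzWith.of_dist_le_mul fun x y => ?_
  rw [Real.dist_eq, dist_eq_norm, abs_le]
  have h1 := h x y
  have h2 := h y x
  rw [norm_sub_rev] at h2
  simp
  constructor <;> linarith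

lemma dir_lip {u : E → ℝ} (hu : LipschitzWith 1 u) {p p' e e' : E} {r : ℝ} (hr : 0 < r)
    (he : ‖e‖ = 1) (he' : ‖e'‖ = 1)
    (h1 : u (p + r • e) = u p + r) (h2 : u (p - r • e) = u p - r)
    (h1' : u (p' + r • e') = u p' + r) (h2' : u (p' - r • e') = u p' - r) :
    r * ‖e - e'‖ ≤ ‖p - p'‖ := by
  have a := lip_le hu (p' + r • e') (p - r • e)
  have b := lip_le hu (p + r • e) (p' - r • e')
  rw [h1', h2] at a
  rw [h1, h2'] at b
  have ea : p' + r • e' - (p - r • e) = r • (e + e') - (p - p') := by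
    rw [smul_add]; abel
  have eb : p + r • e - (p' - r • e') = r • (e + e') + (p - p') := by
    rw [smul_add]; abel
  rw [ea] at a
  rw [eb] at b
  have par := parallelogram_law_with_norm ℝ (r • (e + e')) (p - p')
  have par2 := parallelogram_law_with_norm ℝ e e'
  rw [norm_smul, Real.norm_eq_abs, abs_of_pos hr] at par
  rw [he, he'] at par2
  set A := ‖r • (e + e') - (p - p')‖
  set B := ‖r • (e + e') + (p - p')‖
  have hAB : 4 * r ≤ A + B := by linarith
  apply le_of_sq_le_sq _ (norm_nonneg _) |> fun h => h
  have : (A + B) ^ 2 ≤ 2 * (A * A + B * B) := by nlinarith [sq_nonneg (A - B)]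
  have : (4 * r) ^ 2 ≤ (A + B) ^ 2 := by gcongr
  have : ‖e + e'‖ * ‖e + e'‖ = 4 - ‖e - e'‖ * ‖e - e'‖ := by linarith
  have : (r * ‖e + e'‖) * (r * ‖e + e'‖) = r^2 * (4 - ‖e - e'‖ * ‖e - e'‖) := by rw [← this]; ring
  nlinarith

lemma ray_mid {u : E → ℝ} (hu : LipschitzWith 1 u) {x e : E} {l s : ℝ} (he : ‖e‖ = 1)
    (h : u (x + l • e) = u x + l) (hs : 0 ≤ s) (hsl : s ≤ l) : u (x + s • e) = u x + s := by
  have a := lip_le hu (x + s • e) x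
  have b := lip_le hu (x + l • e) (x + s • e)
  have e1 : x + s • e - x = s • e := by abel
  have e2 : x + l • e - (x + s • e) = (l - s) • e := by rw [sub_smul]; abel
  rw [e1, norm_smul, he, Real.norm_eq_abs, abs_of_nonneg hs] at a
  rw [e2, norm_smul, he, Real.norm_eq_abs, abs_of_nonneg (by linarith)] at b
  linarith

lemma back_le {u : E → ℝ} (hu : LipschitzWith 1 u) {Ω : Set E} {x e : E} {l t : ℝ}
    (he : ‖e‖ = 1) (hx : x ∈ lowEnd u Ω)
    (h : u (x + l • e) = u x + l) (ht : 0 < t) (htl : t < l) {w : E} (hw : w ∈ Ω)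
    (hpw : u (x + t • e) - u w = ‖w - (x + t • e)‖) : ‖w - (x + t • e)‖ ≤ t := by
  by_contra! hlt
  have hp := ray_mid hu he h ht.le htl.le
  set p := x + t • e with hpdef
  set τ := ‖w - p‖ with hτ
  have hτ0 : 0 < τ := ht.trans hlt
  set e' := τ⁻¹ • (p - w) with he'def
  have he' : ‖e'‖ = 1 := by
    rw [he'def, norm_smul, norm_inv, Real.norm_eq_abs, abs_of_pos hτ0, norm_sub_rev, ← hτ]
    exact inv_mul_cancel₀ hτ0.ne'
  have hpw' : p - w = τ • e' := by rw [he'def, smul_smul, mul_inv_cancel₀ hτ0.ne', one_smul]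
  have a := lip_le hu (x + l • e) w
  set s := l - t with hs
  have hs0 : 0 < s := by linarith
  have e1 : x + l • e - w = s • e + τ • e' := by
    rw [← hpw', hs, sub_smul, hpdef]; abel
  rw [e1] at a
  have hge : s + τ ≤ ‖s • e + τ • e'‖ := by linarith
  have hsq := norm_add_sq_real (s • e) (τ • e')
  rw [norm_smul, norm_smul, he, he', inner_smul_left, inner_smul_right, Real.norm_eq_abs,
    Real.norm_eq_abs, abs_of_pos hs0, abs_of_pos hτ0] at hsq
  simp at hsq
  have h2 : (s + τ) ^ 2 ≤ ‖s • e + τ • e'‖ ^ 2 := by gcongr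
  have hin : 1 ≤ inner ℝ e e' := by
    by_contra! hc
    have : 0 < s * τ := by positivity
    nlinarith
  have hin2 : inner ℝ e e' ≤ 1 := by
    have := real_inner_le_norm e e'
    rw [he, he'] at this; linarith
  have hee : e = e' := (inner_eq_one_iff_of_norm_eq_one (𝕜 := ℝ) he he').1 (le_antisymm hin2 hin)
  have hwx : w - x = (t - τ) • e := by
    have : w = p - τ • e := by rw [hee, ← hpw']; abel
    rw [this, hpdef, sub_smul]; abel
  have hn : ‖w - x‖ = τ - t := by
    rw [hwx, norm_smul, he, Real.norm_eq_abs, abs_of_neg (by linarith)]; ring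
  have hne : w ≠ x := by
    rintro rfl
    simp at hn; linarith
  have := hx w hw hne
  linarith

variable [FiniteDimensional ℝ E] [MeasurableSpace E] [BorelSpace E]

lemma meas_back {u : E → ℝ} (hu : LipschitzWith 1 u) {Ω : Set E} (ho : IsOpen Ω) (c : ℝ) :
    MeasurableSet (backSet u Ω c) := by
  obtain ⟨F, hF, -, hFU, -⟩ := ho.exists_iUnion_isClosed
  have huc := hu.continuous
  have : backSet u Ω c = ⋃ m, Prod.fst '' {q : E × E | q.2 ∈ F m ∧
      (u q.1 - u q.2 = ‖q.2 - q.1‖ ∧ c ≤ ‖q.2 - q.1‖)} := by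
    ext p
    simp only [backSet, mem_ofPred_eq, mem_iUnion, mem_image, Prod.exists, exists_and_right,
      exists_eq_right, ← hFU]
    constructor
    · rintro ⟨x, ⟨m, hm⟩, h⟩; exact ⟨m, x, hm, h⟩
    · rintro ⟨m, x, hm, h⟩; exact ⟨x, ⟨m, hm⟩, h⟩
  rw [this]
  refine MeasurableSet.iUnion fun m => ?_
  have hcl : IsClosed {q : E × E | q.2 ∈ F m ∧
      (u q.1 - u q.2 = ‖q.2 - q.1‖ ∧ c ≤ ‖q.2 - q.1‖)} := by
    refine ((hF m).preimage continuous_snd).inter (IsClosed.inter ?_ ?_)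
    · exact isClosed_eq (f := fun q : E × E => u q.1 - u q.2) (g := fun q => ‖q.2 - q.1‖)
        (by fun_prop) (by fun_prop)
    · exact isClosed_le (f := fun _ : E × E => c) (g := fun q => ‖q.2 - q.1‖)
        (by fun_prop) (by fun_prop)
  have hs := (isSigmaCompact_univ (X := E × E)).of_isClosed_subset hcl (subset_univ _)
  obtain ⟨K, hK, hKU⟩ := hs.image continuous_fst
  rw [← hKU]
  exact MeasurableSet.iUnion fun i => (hK i).measurableSet

lemma bot_eq {u : E → ℝ} (hu : LipschitzWith 1 u) (Ω : Set E) :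
    lowEnd u Ω = (⋃ k : ℕ, backSet u Ω (1 / (k + 1 : ℝ)))ᶜ := by
  ext y
  simp only [lowEnd, backSet, mem_ofPred_eq, mem_compl_iff, mem_iUnion, not_exists, not_and, not_le]
  constructor
  · intro h k x hx h1
    by_contra! h2
    have : 0 < ‖x - y‖ := lt_of_lt_of_le (by positivity) h2
    have := h x hx (by rintro rfl; simp at this)
    linarith
  · intro h x hx hne
    have h0 : 0 < ‖x - y‖ := norm_pos_iff.2 (sub_ne_zero.2 hne)
    have hle := lip_le hu y x
    rw [norm_sub_rev] at hle
    refine lt_of_le_of_ne hle fun heq => ?_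
    obtain ⟨k, hk⟩ := exists_nat_one_div_lt h0
    have := h k x hx heq
    linarith

lemma meas_bot {u : E → ℝ} (hu : LipschitzWith 1 u) {Ω : Set E} (ho : IsOpen Ω) :
    MeasurableSet (lowEnd u Ω) := by
  rw [bot_eq hu]
  exact (MeasurableSet.iUnion fun k => meas_back hu ho _).compl

lemma null_ends_l (ν : Measure E) [ν.IsAddHaarMeasure] {u : E → ℝ} (hu : LipschitzWith 1 u)
    {Ω : Set E} (ho : IsOpen Ω) {l : ℝ} (hl : 0 < l) :
    ν {x | x ∈ Ω ∧ x ∈ lowEnd u Ω ∧ ∃ e : E, ‖e‖ = 1 ∧ u (x + l • e) = u x + l} = 0 := by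
  set S := {x | x ∈ Ω ∧ x ∈ lowEnd u Ω ∧ ∃ e : E, ‖e‖ = 1 ∧ u (x + l • e) = u x + l} with hS
  -- level sets
  let L : ℝ → Set E := fun t => backSet u Ω t \ ⋃ k : ℕ, backSet u Ω (t + 1 / (k + 1 : ℝ))
  have hLm : ∀ t, MeasurableSet (L t) := fun t =>
    (meas_back hu ho _).diff (MeasurableSet.iUnion fun k => meas_back hu ho _)
  have hLd' : ∀ s t, s < t → Disjoint (L s) (L t) := by
    intro s t hst
    rw [Set.disjoint_left]
    rintro p ⟨-, hp⟩ ⟨⟨x, hx, h1, h2⟩, -⟩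
    apply hp
    obtain ⟨k, hk⟩ := exists_nat_one_div_lt (sub_pos.2 hst)
    exact mem_iUnion.2 ⟨k, x, hx, h1, by linarith⟩
  have hLd : Pairwise (Function.onFun Disjoint L) := by
    intro s t hst
    rcases lt_or_gt_of_ne hst with h | h
    · exact hLd' s t h
    · exact (hLd' t s h).symm
  have hc := Measure.countable_meas_pos_of_disjoint_iUnion (μ := ν) hLm hLd
  obtain ⟨t, ht, hLt⟩ : ∃ t ∈ Ioo 0 l, ν (L t) = 0 := by
    by_contra! hcon
    have hsub : Ioo 0 l ⊆ {i | 0 < ν (L i)} := fun t ht => pos_iff_ne_zero.2 (hcon t ht)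
    have := (hc.mono hsub).measure_zero volume
    simp at this
    linarith
  choose! e he heu using fun x (hx : x ∈ S) => hx.2.2
  let T : E → E := fun x => x + t • e x
  set r := min t (l - t) with hr
  have hr0 : 0 < r := lt_min ht.1 (sub_pos.2 ht.2)
  have key : ∀ x ∈ S, ∀ y ∈ S, ‖x - y‖ ≤ (1 + t / r) * ‖T x - T y‖ := by
    have aux : ∀ x ∈ S, u (T x + r • e x) = u (T x) + r ∧ u (T x - r • e x) = u (T x) - r := by
      intro x hx
      have h0 := ray_mid hu (he x hx) (heu x hx) ht.1.le ht.2.le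
      have hrt : r ≤ t := min_le_left _ _
      have hrl : r ≤ l - t := min_le_right _ _
      have h1 := ray_mid hu (he x hx) (heu x hx) (s := t + r) (by linarith) (by linarith)
      have h2 := ray_mid hu (he x hx) (heu x hx) (s := t - r) (by linarith) (by linarith)
      rw [add_smul, ← add_assoc] at h1
      rw [sub_smul, ← add_sub_assoc] at h2
      simp only [T]
      constructor <;> linarith
    intro x hx y hy
    have hd := dir_lip hu hr0 (he x hx) (he y hy) (aux x hx).1 (aux x hx).2 (aux y hy).1 (aux y hy).2
    have e1 : x - y = (T x - T y) - t • (e x - e y) := by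
      simp only [T, smul_sub]; abel
    have h3 : ‖e x - e y‖ ≤ ‖T x - T y‖ / r := by
      rw [le_div_iff₀ hr0]; linarith
    calc ‖x - y‖ ≤ ‖T x - T y‖ + ‖t • (e x - e y)‖ := by rw [e1]; exact norm_sub_le _ _
      _ = ‖T x - T y‖ + t * ‖e x - e y‖ := by
        rw [norm_smul, Real.norm_eq_abs, abs_of_pos ht.1]
      _ ≤ ‖T x - T y‖ + t * (‖T x - T y‖ / r) := by gcongr; exact ht.1.le
      _ = _ := by ring
  have hTL : T '' S ⊆ L t := by
    rintro _ ⟨x, hx, rfl⟩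
    have h0 := ray_mid hu (he x hx) (heu x hx) ht.1.le ht.2.le
    have hn : ‖x - T x‖ = t := by
      simp [T, norm_smul, he x hx, abs_of_pos ht.1]
    refine ⟨⟨x, hx.1, ?_, hn.ge⟩, ?_⟩
    · rw [hn]; simp only [T]; linarith
    · rw [mem_iUnion]
      rintro ⟨k, w, hw, h1, h2⟩
      have := back_le hu (he x hx) hx.2.1 (heu x hx) ht.1 ht.2 hw h1
      have : (0:ℝ) < 1 / (k + 1 : ℝ) := by positivity
      simp only [T] at h2
      linarith
  have hinj : InjOn T S := by
    intro x hx y hy hxy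
    have := key x hx y hy
    rw [hxy, sub_self, norm_zero, mul_zero] at this
    exact sub_eq_zero.1 (norm_le_zero_iff.1 this)
  have hinv := hinj.leftInvOn_invFunOn
  have hlip : LipschitzOnWith (Real.toNNReal (1 + t / r)) (Function.invFunOn T S) (T '' S) := by
    refine LipschitzOnWith.of_dist_le_mul ?_
    rintro _ ⟨x, hx, rfl⟩ _ ⟨y, hy, rfl⟩
    rw [hinv hx, hinv hy, dist_eq_norm, dist_eq_norm, Real.coe_toNNReal _ (by have := ht.1; positivity)]
    exact key x hx y hy
  have himg : Function.invFunOn T S '' (T '' S) = S := hinv.image_image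
  set d : ℝ := (Module.finrank ℝ E : ℝ)
  have hH : (Measure.hausdorffMeasure d : Measure E) (T '' S) = 0 := by
    have hac : (Measure.hausdorffMeasure d : Measure E) ≪ ν :=
      Measure.absolutelyContinuous_isAddHaarMeasure _ _
    exact hac (measure_mono_null hTL hLt)
  have hle := hlip.hausdorffMeasure_image_le (d := d) (by positivity)
  rw [himg, hH, mul_zero] at hle
  have hac : ν ≪ (Measure.hausdorffMeasure d : Measure E) :=
      Measure.absolutelyContinuous_isAddHaarMeasure _ _
  exact hac (le_antisymm hle bot_le)

lemma null_ends (ν : Measure E) [ν.IsAddHaarMeasure] {u : E → ℝ} (hu : LipschitzWith 1 u)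
    {Ω : Set E} (ho : IsOpen Ω) :
    ν {x | x ∈ Ω ∧ x ∈ lowEnd u Ω ∧ ∃ z : E, z ≠ x ∧ u z - u x = ‖z - x‖} = 0 := by
  refine measure_mono_null ?_ (measure_iUnion_null fun k : ℕ =>
    null_ends_l ν hu ho (l := 1 / (k + 1 : ℝ)) (by positivity))
  rintro x ⟨hx, hb, z, hz, h⟩
  have h0 : 0 < ‖z - x‖ := norm_pos_iff.2 (sub_ne_zero.2 hz)
  obtain ⟨k, hk⟩ := exists_nat_one_div_lt h0
  have he : ‖(‖z - x‖⁻¹ • (z - x))‖ = 1 := by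
    rw [norm_smul, norm_inv, norm_norm, inv_mul_cancel₀ h0.ne']
  refine mem_iUnion.2 ⟨k, hx, hb, ‖z - x‖⁻¹ • (z - x), he, ?_⟩
  refine ray_mid hu he (l := ‖z - x‖) ?_ (by positivity) hk.le
  rw [smul_smul, mul_inv_cancel₀ h0.ne', one_smul, add_sub_cancel]
  linarith

lemma exists_perturb {u : E → ℝ} (hu : LipschitzWith 1 u) {Ω : Set E} (hne : Ω.Nonempty)
    (h : E → ℝ) (hh : ∀ x, 0 ≤ h x) :
    ∃ v : E → ℝ, LipschitzWith 1 v ∧ (∀ y, u y ≤ v y) ∧ (∀ y ∈ Ω, v y ≤ u y + h y) ∧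
      ∀ y c, (∀ x ∈ Ω, c ≤ u x + h x + ‖y - x‖) → c ≤ v y := by
  have : Nonempty Ω := hne.to_subtype
  have hb : ∀ y, BddBelow (range fun x : Ω => u (x : E) + h (x : E) + ‖y - (x : E)‖) := by
    intro y
    refine ⟨u y, ?_⟩
    rintro _ ⟨x, rfl⟩
    have := lip_le hu y x
    have := hh x
    simp only
    linarith
  refine ⟨fun y => ⨅ x : Ω, (u (x : E) + h (x : E) + ‖y - (x : E)‖), lip_of fun y z => ?_, fun y => ?_, ?_, ?_⟩
  · rw [sub_le_iff_le_add', ← sub_le_iff_le_add]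
    refine le_ciInf fun x => ?_
    have h1 := ciInf_le (hb y) x
    have h2 : ‖y - x‖ ≤ ‖y - z‖ + ‖z - x‖ := norm_sub_le_norm_sub_add_norm_sub _ _ _
    linarith
  · refine le_ciInf fun x => ?_
    have := lip_le hu y x
    have := hh x
    linarith
  · intro y hy
    have := ciInf_le (hb y) ⟨y, hy⟩
    simpa using this
  · intro y c hc
    exact le_ciInf fun x => hc x x.2

lemma exists_gap {u : E → ℝ} (hu : LipschitzWith 1 u) {Ω U : Set E} (ho : IsOpen Ω)
    (hU : IsOpen U) {y : E} (hy : y ∈ Ω) (hyU : y ∈ U) (hb : y ∈ lowEnd u Ω) :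
    ∃ η > 0, ∀ x, x ∉ U → u y + η ≤ u x + ‖y - x‖ := by
  obtain ⟨δ, hδ, hball⟩ := Metric.nhds_basis_closedBall.mem_iff.1 ((ho.inter hU).mem_nhds ⟨hy, hyU⟩)
  have hcont : Continuous fun w => u w + δ - u y := by
    have := hu.continuous
    fun_prop
  obtain ⟨η, hη, hmin⟩ : ∃ η > 0, ∀ w ∈ Metric.sphere y δ, η ≤ u w + δ - u y := by
    rcases (Metric.sphere y δ).eq_empty_or_nonempty with h | h
    · exact ⟨1, one_pos, by simp [h]⟩
    · obtain ⟨w, hw, hm⟩ := (isCompact_sphere y δ).exists_isMinOn h hcont.continuousOn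
      refine ⟨_, ?_, fun w' hw' => hm hw'⟩
      have hwn : ‖w - y‖ = δ := by simpa [dist_eq_norm] using hw
      have := hb w (hball (Metric.sphere_subset_closedBall hw)).1
        (by rintro rfl; simp at hwn; linarith)
      linarith
  refine ⟨η, hη, fun x hx => ?_⟩
  have hxd : δ < ‖x - y‖ := by
    by_contra! hc
    exact hx (hball (by simpa [dist_eq_norm] using hc)).2
  have h0 : 0 < ‖x - y‖ := hδ.trans hxd
  set e := ‖x - y‖⁻¹ • (x - y) with hedef
  have he : ‖e‖ = 1 := by
    rw [hedef, norm_smul, norm_inv, norm_norm, inv_mul_cancel₀ h0.ne']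
  have hxe : x - y = ‖x - y‖ • e := by rw [hedef, smul_smul, mul_inv_cancel₀ h0.ne', one_smul]
  have h1 := hmin (y + δ • e) (by simp [norm_smul, he, abs_of_pos hδ])
  have h2 := lip_le hu (y + δ • e) x
  have h3 : y + δ • e - x = (δ - ‖x - y‖) • e := by
    rw [sub_smul, ← hxe]; abel
  rw [h3, norm_smul, he, Real.norm_eq_abs, abs_of_neg (by linarith)] at h2
  rw [norm_sub_rev y x]
  linarith

lemma var_nonpos (μ : Measure E) {u : E → ℝ} (hu : LipschitzWith 1 u) {Ω : Set E}
    (hne : Ω.Nonempty) (ho : IsOpen Ω) (hμ : ∀ᵐ x ∂μ, x ∈ Ω) {f : E → ℝ} (hf : Integrable f μ)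
    (huf : Integrable (fun x => u x * f x) μ)
    (hmax : ∀ v : E → ℝ, LipschitzWith 1 v → ∫ x, v x * f x ∂μ ≤ ∫ x, u x * f x ∂μ) :
    ∀ᵐ x ∂μ, x ∈ lowEnd u Ω → f x ≤ 0 := by
  set g := hf.1.mk f with hg
  have hgm : Measurable g := hf.1.stronglyMeasurable_mk.measurable
  have hfg : f =ᵐ[μ] g := hf.1.ae_eq_mk
  set K := Ω ∩ lowEnd u Ω ∩ {x | 0 < g x} with hK
  have hKm : MeasurableSet K :=
    (ho.measurableSet.inter (meas_bot hu ho)).inter (measurableSet_lt measurable_const hgm)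
  have main : ∀ δ : ℝ, 0 < δ → ∫ x in K, f x ∂μ ≤ δ := by
    intro δ hδ
    let ν := μ.withDensity (fun x => ‖f x‖ₑ)
    have : IsFiniteMeasure ν := isFiniteMeasure_withDensity hf.2.ne
    obtain ⟨U, hKU, hUo, -, hUK⟩ := hKm.exists_isOpen_sdiff_lt (μ := ν) (measure_ne_top _ _)
      (ε := ENNReal.ofReal δ) (by simpa using hδ)
    have hUKm : MeasurableSet (U \ K) := hUo.measurableSet.diff hKm
    have herr : ∫ x in U \ K, ‖f x‖ ∂μ ≤ δ := by
      rw [withDensity_apply _ hUKm] at hUK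
      rw [integral_norm_eq_lintegral_enorm hf.1.restrict]
      exact ENNReal.toReal_le_of_le_ofReal hδ.le hUK.le
    have hε : ∀ k : ℕ, (0:ℝ) < 1 / (k + 1 : ℝ) := fun k => by positivity
    choose v hvl hv1 hv2 hv3 using fun k : ℕ => exists_perturb hu hne
      (U.indicator fun _ => 1 / (k + 1 : ℝ)) (fun x => indicator_nonneg (fun _ _ => (hε k).le) x)
    let w : ℕ → E → ℝ := fun k x => (v k x - u x) / (1 / (k + 1 : ℝ))
    have hw0 : ∀ k x, 0 ≤ w k x := fun k x => div_nonneg (sub_nonneg.2 (hv1 k x)) (hε k).le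
    have hw1 : ∀ k, ∀ x ∈ Ω, w k x ≤ 1 := by
      intro k x hx
      simp only [w]
      rw [div_le_one (hε k)]
      have := hv2 k x hx
      have h2 : U.indicator (fun _ => 1 / (k + 1 : ℝ)) x ≤ 1 / (k + 1 : ℝ) :=
        indicator_le_self' (fun _ _ => (hε k).le) x
      linarith
    have hwU : ∀ k, ∀ x ∈ Ω, x ∉ U → w k x = 0 := by
      intro k x hx hxU
      have h1 := hv2 k x hx
      rw [indicator_of_notMem hxU] at h1
      have h2 := hv1 k x
      have : v k x - u x = 0 := by linarith
      simp [w, this]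
    have hwK : ∀ x ∈ K, ∀ᶠ k in atTop, w k x = 1 := by
      intro x hx
      obtain ⟨η, hη, hgap⟩ := exists_gap hu ho hUo hx.1.1 (hKU hx) hx.1.2
      have hev : ∀ᶠ k : ℕ in atTop, 1 / (k + 1 : ℝ) < η :=
        tendsto_one_div_add_atTop_nhds_zero_nat.eventually_lt_const hη
      filter_upwards [hev] with k hk
      refine le_antisymm (hw1 k x hx.1.1) ?_
      simp only [w]
      rw [one_le_div (hε k), le_sub_iff_add_le']
      refine hv3 k x _ fun z hz => ?_
      by_cases hzU : z ∈ U
      · rw [indicator_of_mem hzU]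
        have := lip_le hu x z
        linarith
      · rw [indicator_of_notMem hzU]
        have := hgap z hzU
        linarith
    have hwc : ∀ k, Continuous (w k) := fun k =>
      ((hvl k).continuous.sub hu.continuous).div_const _
    have hwf : ∀ k, Integrable (fun x => w k x * f x) μ := by
      intro k
      refine hf.bdd_mul (c := 1) (hwc k).aestronglyMeasurable ?_
      filter_upwards [hμ] with x hx
      rw [Real.norm_eq_abs, abs_of_nonneg (hw0 k x)]
      exact hw1 k x hx
    have hwle : ∀ k, ∫ x, w k x * f x ∂μ ≤ 0 := by
      intro k
      have h1 := hmax (v k) (hvl k)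
      have h2 : (fun x => v k x * f x) =
          fun x => u x * f x + (1 / (k + 1 : ℝ)) * (w k x * f x) := by
        ext x
        have : v k x = u x + (1 / (k + 1 : ℝ)) * w k x := by
          simp only [w]; rw [mul_div_cancel₀ _ (hε k).ne']; ring
        rw [this]; ring
      rw [h2, integral_add huf ((hwf k).const_mul _), integral_const_mul] at h1
      have := hε k
      by_contra! hc
      have := mul_pos this hc
      linarith
    have hlow : ∀ k, ∫ x, K.indicator (fun x => w k x * f x) x ∂μ ≤ δ := by
      intro k
      have hi1 := (hwf k).indicator hKm
      have hi2 : Integrable ((U \ K).indicator fun x => ‖f x‖) μ := hf.norm.indicator hUKm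
      have hm : ∫ x, (K.indicator (fun x => w k x * f x) x
          - (U \ K).indicator (fun x => ‖f x‖) x) ∂μ ≤ ∫ x, w k x * f x ∂μ := by
        refine integral_mono_ae (hi1.sub hi2) (hwf k) ?_
        filter_upwards [hμ] with x hx
        by_cases hxK : x ∈ K
        · simp [hxK]
        · by_cases hxU : x ∈ U
          · have hmem : x ∈ U \ K := ⟨hxU, hxK⟩
            simp only [indicator_of_notMem hxK, indicator_of_mem hmem, zero_sub]
            have h1 : ‖w k x * f x‖ ≤ ‖f x‖ := by
              rw [norm_mul, Real.norm_eq_abs (w k x), abs_of_nonneg (hw0 k x)]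
              exact mul_le_of_le_one_left (norm_nonneg _) (hw1 k x hx)
            have h2 := neg_abs_le (w k x * f x)
            rw [Real.norm_eq_abs] at h1
            linarith
          · have hmem : x ∉ U \ K := fun h => hxU h.1
            simp [indicator_of_notMem hxK, indicator_of_notMem hmem, hwU k x hx hxU]
      rw [integral_sub hi1 hi2, integral_indicator hUKm] at hm
      have := hwle k
      linarith
    have hlim : Tendsto (fun k => ∫ x, K.indicator (fun x => w k x * f x) x ∂μ) atTop
        (𝓝 (∫ x, K.indicator f x ∂μ)) := by
      refine tendsto_integral_of_dominated_convergence (fun x => ‖f x‖)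
        (fun k => ((hwf k).indicator hKm).1) hf.norm ?_ ?_
      · intro k
        filter_upwards [hμ] with x hx
        refine (norm_indicator_le_norm_self _ _).trans ?_
        rw [norm_mul, Real.norm_eq_abs (w k x), abs_of_nonneg (hw0 k x)]
        exact mul_le_of_le_one_left (norm_nonneg _) (hw1 k x hx)
      · refine Eventually.of_forall fun x => ?_
        by_cases hxK : x ∈ K
        · simp only [indicator_of_mem hxK]
          refine tendsto_const_nhds.congr' ?_
          filter_upwards [hwK x hxK] with k hk
          rw [hk, one_mul]
        · simp [indicator_of_notMem hxK]
    rw [integral_indicator hKm] at hlim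
    exact le_of_tendsto' hlim hlow
  have hle : ∫ x in K, f x ∂μ ≤ 0 := le_of_forall_pos_le_add fun δ hδ => by
    simpa using main δ hδ
  have hpos : ∀ᵐ x ∂(μ.restrict K), 0 < f x := by
    rw [ae_restrict_iff' hKm]
    filter_upwards [hfg] with x hx hxK
    rw [hx]; exact hxK.2
  have hnn : 0 ≤ᵐ[μ.restrict K] f := by
    filter_upwards [hpos] with x hx using hx.le
  have h0 : ∫ x in K, f x ∂μ = 0 := le_antisymm hle (integral_nonneg_of_ae hnn)
  have hz := (setIntegral_eq_zero_iff_of_nonneg_ae hnn hf.integrableOn).1 h0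
  have hF : ∀ᵐ x ∂(μ.restrict K), False := by
    filter_upwards [hpos, hz] with x h1 h2
    rw [h2] at h1
    simp at h1
  rw [ae_restrict_iff' hKm] at hF
  filter_upwards [hF, hfg, hμ] with x h1 h2 h3 h4
  by_contra! hc
  exact h1 ⟨⟨h3, h4⟩, by rw [mem_ofPred_eq, ← h2]; exact hc⟩

end Aux

/-- A Kantorovich maximizer `u` for `f` on a weighted convex domain `(Ω, e^{-ρ})`:
`f` vanishes `μ`-almost everywhere outside the strain set of `u`. -/
theorem vanishes_off_strain {n : ℕ} (hn : 2 ≤ n)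
    (Ω : Set (EuclideanSpace ℝ (Fin n))) (hne : Ω.Nonempty) (ho : IsOpen Ω)
    (hconv : Convex ℝ Ω)
    (ρ : EuclideanSpace ℝ (Fin n) → ℝ) (hρ : ContDiffOn ℝ (⊤ : ℕ∞) ρ Ω)
    (μ : Measure (EuclideanSpace ℝ (Fin n)))
    (hμ : μ = (volume.restrict Ω).withDensity fun x => ENNReal.ofReal (Real.exp (-ρ x)))
    (f : EuclideanSpace ℝ (Fin n) → ℝ) (hf : Integrable f μ) (hf0 : ∫ x, f x ∂μ = 0)
    (x₀ : EuclideanSpace ℝ (Fin n)) (hx₀ : x₀ ∈ Ω)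
    (hfd : Integrable (fun x => |f x| * ‖x - x₀‖) μ)
    (u : EuclideanSpace ℝ (Fin n) → ℝ) (hu : LipschitzOnWith 1 u Ω)
    (hmax : ∀ v : EuclideanSpace ℝ (Fin n) → ℝ, LipschitzOnWith 1 v Ω →
      ∫ x, v x * f x ∂μ ≤ ∫ x, u x * f x ∂μ) :
    ∀ᵐ x ∂μ, x ∈ Ω \ strainOn u Ω → f x = 0 := by
  obtain ⟨U, hU, hUe⟩ := hu.extend_real
  have hac1 : μ ≪ volume.restrict Ω := hμ ▸ withDensity_absolutelyContinuous _ _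
  have hac : μ ≪ volume := hac1.trans Measure.absolutelyContinuous_restrict
  have hΩ : ∀ᵐ x ∂μ, x ∈ Ω := hac1 (ae_restrict_mem ho.measurableSet)
  have hint : ∫ x, u x * f x ∂μ = ∫ x, U x * f x ∂μ := by
    refine integral_congr_ae ?_
    filter_upwards [hΩ] with x hx
    rw [hUe hx]
  have hUf : Integrable (fun x => U x * f x) μ := by
    refine ((hf.norm.const_mul |U x₀|).add hfd).mono'
      (hU.continuous.aestronglyMeasurable.mul hf.1) (Filter.Eventually.of_forall fun x => ?_)
    have h1 := lip_le hU x x₀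
    have h2 := lip_le hU x₀ x
    rw [norm_sub_rev] at h2
    have h3 : |U x| ≤ |U x₀| + ‖x - x₀‖ := by
      have := neg_abs_le (U x₀)
      have := le_abs_self (U x₀)
      rw [abs_le]; constructor <;> linarith
    simp only [norm_mul, Real.norm_eq_abs, Pi.add_apply]
    calc |U x| * |f x| ≤ (|U x₀| + ‖x - x₀‖) * |f x| := by gcongr
      _ = _ := by ring
  have hnU : LipschitzWith 1 (fun x => - U x) := hU.neg
  have hA := var_nonpos μ hU hne ho hΩ hf hUf (fun v hv => by
    rw [← hint]; exact hmax v hv.lipschitzOnWith)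
  have hB := var_nonpos μ hnU hne ho hΩ (f := fun x => - f x) hf.neg
    (by simpa using hUf) (fun v hv => by
      have := hmax (fun x => - v x) hv.neg.lipschitzOnWith
      rw [hint] at this
      simpa [integral_neg] using this)
  have hC := hac (compl_mem_ae_iff.2 (null_ends volume hU ho))
  have hD := hac (compl_mem_ae_iff.2 (null_ends volume hnU ho))
  filter_upwards [hA, hB, hC, hD] with y hA hB hC hD hy
  have hyΩ := hy.1
  -- dichotomy
  have hor : y ∈ lowEnd U Ω ∨ y ∈ lowEnd (fun x => - U x) Ω := by
    by_contra! hcon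
    obtain ⟨h1, h2⟩ := hcon
    simp only [lowEnd, Set.mem_ofPred_eq, not_forall, not_lt] at h1 h2
    obtain ⟨x, hx, hxy, hx2⟩ := h1
    obtain ⟨z, hz, hzy, hz2⟩ := h2
    apply hy.2
    have a1 := lip_le hU y x
    have a2 := lip_le hU z y
    have a3 := lip_le hU z x
    have a4 : ‖x - z‖ ≤ ‖x - y‖ + ‖y - z‖ := norm_sub_le_norm_sub_add_norm_sub _ _ _
    rw [norm_sub_rev] at a1 a2 a3
    rw [norm_sub_rev] at hz2
    refine ⟨hyΩ, x, hx, z, hz, ?_, norm_pos_iff.2 (sub_ne_zero.2 hxy), ?_,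
      norm_pos_iff.2 (sub_ne_zero.2 (Ne.symm hzy)), ?_⟩
    · rw [hUe hx, hUe hyΩ]; linarith
    · rw [hUe hz, hUe hyΩ]; linarith
    · linarith
  have hand : y ∈ lowEnd U Ω ∧ y ∈ lowEnd (fun x => - U x) Ω := by
    rcases hor with h | h
    · refine ⟨h, fun z hz hzy => ?_⟩
      by_contra! hc
      refine hC ⟨hyΩ, h, z, hzy, ?_⟩
      have := lip_le hU z y
      linarith
    · refine ⟨fun z hz hzy => ?_, h⟩
      by_contra! hc
      refine hD ⟨hyΩ, h, z, hzy, ?_⟩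
      have := lip_le hnU z y
      linarith
  have h1 := hA hand.1
  have h2 := hB hand.2
  linarith
end

section
/- Let n ≥ 2, let Ω ⊆ ℝⁿ be a nonempty open convex set, ρ : Ω → ℝ smooth, and μ the measure on Ω with density e^{−ρ} with respect to Lebesgue measure. Let f : Ω → ℝ be μ-integrable with ∫_Ω f dμ = 0 and ∫_Ω |f(x)|·‖x−x₀‖ dμ(x) < ∞ for some x₀ ∈ Ω, and assume μ({x ∈ Ω : f(x) = 0}) = 0. If u₁, u₂ : Ω → ℝ are both 1-Lipschitz and both attain the supremum sup{ ∫_Ω v f dμ : v 1-Lipschitz }, then u₁ − u₂ is a constant function on Ω. (Uniqueness of the Kantorovich maximizer.) -/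
open MeasureTheory Set Filter Topology

section
variable {E : Type*} [NormedAddCommGroup E] [MeasurableSpace E] [BorelSpace E]

lemma km_key (μ : Measure E) (Ω : Set E) (hΩ : ∀ᵐ x ∂μ, x ∈ Ω)
    (f u : E → ℝ) (hf : Integrable f μ) (hu : LipschitzWith 1 u)
    (huf : Integrable (fun x => u x * f x) μ)
    (hmax : ∀ v : E → ℝ, LipschitzWith 1 v → ∫ x, v x * f x ∂μ ≤ ∫ x, u x * f x ∂μ)
    (K : Set E) (hK : IsCompact K) (hKn : K.Nonempty)
    (hs : ∀ x ∈ Ω, ∀ y ∈ K, x ≠ y → u x - u y < dist x y) :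
    0 ≤ ∫ x in K, f x ∂μ := by
  have hdu : ∀ x y, u x - u y ≤ dist x y := fun x y => by
    have := hu.dist_le_mul x y
    rw [Real.dist_eq] at this
    simp at this
    exact (le_abs_self _).trans this
  have : Nonempty K := hKn.to_subtype
  set g : E → ℝ := fun x => ⨅ y : K, (u y + dist x y) with hg
  have hbdd : ∀ x : E, BddBelow (range fun y : K => u y + dist x y) := fun x =>
    ⟨u x, by rintro _ ⟨y, rfl⟩; have := hdu x y; simp only; linarith⟩
  have hgu : ∀ x, u x ≤ g x := fun x => le_ciInf fun y => by have := hdu x y; linarith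
  have hgK : ∀ x ∈ K, g x = u x := fun x hx => le_antisymm (by
    have := ciInf_le (hbdd x) ⟨x, hx⟩; simpa using this) (hgu x)
  have hgs : ∀ x ∈ Ω, x ∉ K → u x < g x := fun x hx hxK => by
    obtain ⟨y, hy, hmin⟩ := hK.exists_isMinOn hKn
      (f := fun y => u y + dist x y) (by have := hu.continuous; fun_prop)
    have h1 := hs x hx y hy (by rintro rfl; exact hxK hy)
    have : u y + dist x y ≤ g x := le_ciInf fun z => hmin z.2
    linarith
  have hgl : LipschitzWith 1 g := by
    apply LipschitzWith.of_le_add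
    intro x y
    rw [← sub_le_iff_le_add]
    refine le_ciInf fun z => ?_
    have h1 : g x ≤ u z + dist x z := ciInf_le (hbdd x) z
    have := dist_triangle x y z
    linarith
  let φ : ℕ → E → ℝ := fun n x => max 0 (1 - (g x - u x) * (n + 1))
  have hφc : ∀ n, Continuous (φ n) := fun n => by
    have := hu.continuous
    have := hgl.continuous
    fun_prop
  have hφ0 : ∀ n x, 0 ≤ φ n x := fun n x => le_max_left _ _
  have hφ1 : ∀ n x, φ n x ≤ 1 := fun n x => max_le zero_le_one (by
    have : 0 ≤ (g x - u x) * (n + 1) := mul_nonneg (by linarith [hgu x]) (by positivity)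
    linarith)
  have hφi : ∀ n, Integrable (fun x => φ n x * f x) μ := fun n =>
    hf.bdd_mul (c := 1) (hφc n).aestronglyMeasurable
      (Eventually.of_forall fun x => by
        rw [Real.norm_eq_abs, abs_of_nonneg (hφ0 n x)]; exact hφ1 n x)
  have hpos : ∀ n, 0 ≤ ∫ x, φ n x * f x ∂μ := fun n => by
    have hv : LipschitzWith 1 (fun x => min (u x) (g x - 1 / ((n:ℝ) + 1))) := by
      have h2 : LipschitzWith 1 (fun x => g x - 1 / ((n:ℝ) + 1)) := by
        apply LipschitzWith.of_le_add
        intro x y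
        have := (abs_le.1 (by simpa [Real.dist_eq] using hgl.dist_le_mul x y)).2
        linarith
      simpa using hu.min h2
    have hm := hmax _ hv
    have he : ∀ x, min (u x) (g x - 1 / ((n:ℝ) + 1)) * f x
        = u x * f x - (1 / ((n:ℝ) + 1)) * (φ n x * f x) := fun x => by
      have hn : (0:ℝ) < n + 1 := by positivity
      have : min (u x) (g x - 1 / ((n:ℝ) + 1)) = u x - (1 / ((n:ℝ) + 1)) * φ n x := by
        simp only [φ]
        rw [mul_max_of_nonneg _ _ (by positivity), sub_eq_add_neg (u x), ← min_neg_neg,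
          ← min_add_add_left]
        congr 1
        · simp
        · field_simp; ring
      rw [this]; ring
    simp_rw [he] at hm
    rw [integral_sub huf ((hφi n).const_mul _), integral_const_mul] at hm
    have hn : (0:ℝ) < 1 / (n + 1) := by positivity
    by_contra! hc
    have := mul_neg_of_pos_of_neg hn hc
    linarith
  have hlim : Tendsto (fun n => ∫ x, φ n x * f x ∂μ) atTop
      (𝓝 (∫ x, K.indicator f x ∂μ)) := by
    refine tendsto_integral_of_dominated_convergence (fun x => ‖f x‖)
      (fun n => (hφi n).aestronglyMeasurable) hf.norm
      (fun n => Eventually.of_forall fun x => ?_) ?_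
    · rw [norm_mul, Real.norm_eq_abs (φ n x), abs_of_nonneg (hφ0 n x)]
      exact mul_le_of_le_one_left (norm_nonneg _) (hφ1 n x)
    · filter_upwards [hΩ] with x hx
      by_cases hxK : x ∈ K
      · have : ∀ n, φ n x * f x = K.indicator f x := fun n => by
          simp [φ, hgK x hxK, hxK]
        simp_rw [this]; exact tendsto_const_nhds
      · have hp : 0 < g x - u x := by linarith [hgs x hx hxK]
        obtain ⟨N, hN⟩ := exists_nat_gt (1 / (g x - u x))
        refine tendsto_const_nhds.congr' ?_
        filter_upwards [eventually_ge_atTop N] with n hn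
        have h1 : (N:ℝ) ≤ n := by exact_mod_cast hn
        have h2 : 1 < (N:ℝ) * (g x - u x) := by rwa [div_lt_iff₀ hp] at hN
        have h3 : φ n x = 0 := max_eq_left (by nlinarith)
        simp [h3, hxK]
  rw [integral_indicator hK.measurableSet] at hlim
  exact ge_of_tendsto' hlim hpos
end

lemma km_grad {E : Type*} [NormedAddCommGroup E] [InnerProductSpace ℝ E] [CompleteSpace E]
    (u : E → ℝ) (hu : LipschitzWith 1 u) (x y : E) (hxy : x ≠ y) (hd : DifferentiableAt ℝ u x)
    (s : ℝ) (hs : s = 1 ∨ s = -1) (h : u y - u x = s * dist x y) :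
    gradient u x = (s / ‖y - x‖) • (y - x) := by
  set e := y - x with he
  have hen : 0 < ‖e‖ := norm_pos_iff.2 (sub_ne_zero.2 hxy.symm)
  have hdist : dist x y = ‖e‖ := by rw [dist_comm, dist_eq_norm]
  have hdu : ∀ a b, |u a - u b| ≤ ‖a - b‖ := fun a b => by
    simpa [Real.dist_eq, dist_eq_norm] using hu.dist_le_mul a b
  have hline : ∀ t ∈ Icc (0:ℝ) 1, u (x + t • e) = u x + t * (s * ‖e‖) := by
    intro t ht
    have h1 := abs_le.1 (hdu (x + t • e) x)
    have h2 := abs_le.1 (hdu y (x + t • e))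
    have e1 : ‖x + t • e - x‖ = t * ‖e‖ := by
      rw [add_sub_cancel_left, norm_smul, Real.norm_eq_abs, abs_of_nonneg ht.1]
    have e2 : ‖y - (x + t • e)‖ = (1 - t) * ‖e‖ := by
      have : y - (x + t • e) = (1 - t) • e := by rw [sub_smul, one_smul, he]; abel
      rw [this, norm_smul, Real.norm_eq_abs, abs_of_nonneg (by linarith [ht.2])]
    rw [e1] at h1
    rw [e2] at h2
    rw [hdist] at h
    rcases hs with rfl | rfl <;> nlinarith
  have hder : HasDerivAt (fun t : ℝ => u (x + t • e)) (inner ℝ (gradient u x) e) 0 := by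
    have h1 : HasFDerivAt u (fderiv ℝ u x) (x + (0:ℝ) • e) := by simpa using hd.hasFDerivAt
    have h2 : HasDerivAt (fun t : ℝ => x + t • e) e 0 := by
      simpa using ((hasDerivAt_id (0:ℝ)).smul_const e).const_add x
    have := h1.comp_hasDerivAt (0:ℝ) h2
    have h3 : inner ℝ (gradient u x) e = fderiv ℝ u x e := by simp [gradient]
    rw [h3]; exact this
  have hder2 : HasDerivWithinAt (fun t : ℝ => u (x + t • e)) (s * ‖e‖) (Icc 0 1) 0 := by
    have : HasDerivAt (fun t : ℝ => u x + t * (s * ‖e‖)) (s * ‖e‖) 0 := by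
      simpa using ((hasDerivAt_id (0:ℝ)).mul_const (s * ‖e‖)).const_add (u x)
    exact this.hasDerivWithinAt.congr hline (hline 0 (by simp))
  have hin : inner ℝ (gradient u x) e = s * ‖e‖ :=
    (uniqueDiffOn_Icc (zero_lt_one' ℝ) 0 (by simp)).eq_deriv _ hder.hasDerivWithinAt hder2
  have hn : ‖gradient u x‖ ≤ 1 := by
    have := norm_fderiv_le_of_lipschitz ℝ hu (x₀ := x)
    simpa [gradient] using this
  have hss : s * s = 1 := by rcases hs with rfl | rfl <;> norm_num
  have h0 : ‖gradient u x - (s / ‖e‖) • e‖ ^ 2 ≤ 0 := by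
    rw [norm_sub_sq_real, inner_smul_right, hin, norm_smul, Real.norm_eq_abs, mul_pow, sq_abs]
    have : s / ‖e‖ * (s * ‖e‖) = 1 := by field_simp; nlinarith
    rw [this]
    have : (s / ‖e‖) ^ 2 * ‖e‖ ^ 2 = 1 := by field_simp; nlinarith
    rw [this]
    have : ‖gradient u x‖ ^ 2 ≤ 1 := by nlinarith [norm_nonneg (gradient u x)]
    linarith
  have : ‖gradient u x - (s / ‖e‖) • e‖ = 0 := by
    have := sq_nonneg ‖gradient u x - (s / ‖e‖) • e‖
    exact pow_eq_zero_iff two_ne_zero |>.1 (le_antisymm h0 this)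
  exact sub_eq_zero.1 (norm_eq_zero.1 this)

lemma km_const {E : Type*} [NormedAddCommGroup E] [NormedSpace ℝ E] [FiniteDimensional ℝ E]
    [MeasurableSpace E] [BorelSpace E] (ν : Measure E) [ν.IsAddHaarMeasure]
    (Ω : Set E) (ho : IsOpen Ω) (hconv : Convex ℝ Ω) (w : E → ℝ) (C : NNReal)
    (hw : LipschitzWith C w) (hd : ∀ᵐ x ∂ν, x ∈ Ω → HasFDerivAt w (0 : E →L[ℝ] ℝ) x)
    (a b : E) (ha : a ∈ Ω) (hb : b ∈ Ω) : w a = w b := by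
  set e := b - a with he
  obtain ⟨G, hGs, hGm, hG0⟩ : ∃ G : Set E, G ⊆ {x | x ∈ Ω → HasFDerivAt w (0 : E →L[ℝ] ℝ) x} ∧
      MeasurableSet G ∧ ν Gᶜ = 0 := by
    obtain ⟨t, ht, htm, ht0⟩ := exists_measurable_superset_of_null (ae_iff.1 hd)
    refine ⟨tᶜ, ?_, htm.compl, by simpa using ht0⟩
    intro x hx
    by_contra hc
    exact hx (ht hc)
  have hmeas : MeasurableSet {p : E × ℝ | p.1 + p.2 • e ∈ G} := by
    have : Measurable (fun p : E × ℝ => p.1 + p.2 • e) := by fun_prop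
    exact this hGm
  have hae : ∀ᵐ x ∂ν, ∀ᵐ t ∂(volume : Measure ℝ), x + t • e ∈ G := by
    rw [Measure.ae_ae_comm (p := fun x t => x + t • e ∈ G) hmeas]
    refine Eventually.of_forall fun t => ?_
    have : ∀ᵐ x ∂ν, x ∈ G := hG0
    exact (measurePreserving_add_right ν (t • e)).quasiMeasurePreserving.ae this
  have hdense := Measure.dense_of_ae hae
  have hU : IsOpen (Ω ∩ (fun x => x + e) ⁻¹' Ω) :=
    ho.inter (ho.preimage (by fun_prop))
  have haU : a ∈ Ω ∩ (fun x => x + e) ⁻¹' Ω := ⟨ha, by simpa [he] using hb⟩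
  have hcl : a ∈ closure ((Ω ∩ (fun x => x + e) ⁻¹' Ω) ∩ {x | ∀ᵐ t ∂(volume : Measure ℝ), x + t • e ∈ G}) :=
    hdense.open_subset_closure_inter hU haU
  have hclosed : IsClosed {x | w x = w (x + e)} :=
    isClosed_eq hw.continuous (hw.continuous.comp (by fun_prop))
  have hsub : (Ω ∩ (fun x => x + e) ⁻¹' Ω) ∩ {x | ∀ᵐ t ∂(volume : Measure ℝ), x + t • e ∈ G}
      ⊆ {x | w x = w (x + e)} := by
    rintro x ⟨⟨hx, hxe⟩, hxt⟩
    have hl : LipschitzWith ‖e‖₊ (fun t : ℝ => x + t • e) := by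
      apply LipschitzWith.of_dist_le_mul
      intro s t
      rw [dist_add_left, dist_eq_norm, ← sub_smul, norm_smul, mul_comm]
      simp [Real.dist_eq]
    have hac : AbsolutelyContinuousOnInterval (fun t : ℝ => w (x + t • e)) 0 1 :=
      ((hw.comp hl).lipschitzOnWith (s := uIcc 0 1)).absolutelyContinuousOnInterval
    obtain ⟨c, hc⟩ := hac.const_of_ae_hasDerivAt_zero (by
      filter_upwards [hxt] with t ht htI
      rw [uIcc_of_le zero_le_one] at htI
      have hin : x + t • e ∈ Ω := by
        have := hconv.add_smul_sub_mem hx hxe htI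
        simpa using this
      have h1 : HasFDerivAt w (0 : E →L[ℝ] ℝ) (x + t • e) := hGs ht hin
      have h2 : HasDerivAt (fun t : ℝ => x + t • e) e t := by
        simpa using ((hasDerivAt_id t).smul_const e).const_add x
      simpa [Function.comp_def] using h1.comp_hasDerivAt t h2)
    have h0 := hc 0 (by simp)
    have h1 := hc 1 (by simp)
    simp only [zero_smul, add_zero, one_smul] at h0 h1
    exact h0.trans h1.symm
  have := closure_minimal hsub hclosed hcl
  simpa [he] using this

lemma km_sign {E : Type*} [NormedAddCommGroup E] [MeasurableSpace E] [BorelSpace E]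
    (μ ν : Measure E) [ν.InnerRegular] (Ω A : Set E) (hA : MeasurableSet A) (hAΩ : A ⊆ Ω)
    (hΩ : MeasurableSet Ω)
    (h1 : μ ≪ ν) (h2 : ν.restrict Ω ≪ μ) (f : E → ℝ) (hf : Integrable f μ)
    (hK : ∀ K, IsCompact K → K.Nonempty → K ⊆ A → ∫ x in K, f x ∂μ ≤ 0) :
    ∀ᵐ x ∂μ, x ∈ A → f x ≤ 0 := by
  obtain ⟨g, hgm, hfg⟩ := hf.1
  have hS : MeasurableSet (A ∩ {x | 0 < g x}) :=
    hA.inter (measurableSet_lt measurable_const hgm.measurable)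
  have hν : ν (A ∩ {x | 0 < g x}) = 0 := by
    by_contra hne
    obtain ⟨K, hKs, hKc, hKpos⟩ := hS.exists_lt_isCompact (pos_iff_ne_zero.2 hne)
    have hKn : K.Nonempty := nonempty_of_measure_ne_zero hKpos.ne'
    have hle := hK K hKc hKn (hKs.trans inter_subset_left)
    have hμK : μ K ≠ 0 := fun h0 => by
      have := h2 h0
      rw [Measure.restrict_apply hKc.measurableSet,
        inter_eq_left.2 ((hKs.trans inter_subset_left).trans hAΩ)] at this
      exact hKpos.ne' this
    have hgi : Integrable g μ := hf.congr hfg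
    rw [integral_congr_ae (ae_restrict_of_ae hfg)] at hle
    have hpos : 0 < ∫ x in K, g x ∂μ := by
      rw [setIntegral_pos_iff_support_of_nonneg_ae _ hgi.integrableOn]
      · rw [inter_eq_right.2]
        · exact pos_iff_ne_zero.2 hμK
        · intro x hx; exact (hKs hx).2.ne'
      · filter_upwards [ae_restrict_mem hKc.measurableSet] with x hx using (hKs hx).2.le
    linarith
  have := h1 hν
  filter_upwards [hfg, measure_eq_zero_iff_ae_notMem.1 this] with x hx hx2 hxA
  rw [hx]
  by_contra! hc
  exact hx2 ⟨hxA, hc⟩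

lemma km_meas {E : Type*} [NormedAddCommGroup E] [NormedSpace ℝ E] [FiniteDimensional ℝ E]
    [MeasurableSpace E] [BorelSpace E] (Ω : Set E) (ho : IsOpen Ω) (u : E → ℝ)
    (hu : Continuous u) :
    MeasurableSet {x | x ∈ Ω ∧ ∃ y ∈ Ω, x ≠ y ∧ |u x - u y| = dist x y} := by
  have hU : IsOpen {p : E × E | p.1 ∈ Ω ∧ p.2 ∈ Ω ∧ p.1 ≠ p.2} :=
    (ho.preimage continuous_fst).inter ((ho.preimage continuous_snd).inter
      (isOpen_ne_fun continuous_fst continuous_snd))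
  have hC : IsClosed {p : E × E | |u p.1 - u p.2| = dist p.1 p.2} :=
    isClosed_eq (by fun_prop) (by fun_prop)
  obtain ⟨F, hF, -, hFU, -⟩ := hU.exists_iUnion_isClosed
  have : ProperSpace E := FiniteDimensional.proper_real E
  have hσ : IsSigmaCompact ({p : E × E | p.1 ∈ Ω ∧ p.2 ∈ Ω ∧ p.1 ≠ p.2} ∩
      {p : E × E | |u p.1 - u p.2| = dist p.1 p.2}) := by
    rw [← hFU, iUnion_inter]
    exact isSigmaCompact_iUnion _ fun n =>
      isSigmaCompact_univ.of_isClosed_subset ((hF n).inter hC) (subset_univ _)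
  obtain ⟨L, hL, hLU⟩ := hσ.image continuous_fst
  have heq : {x | x ∈ Ω ∧ ∃ y ∈ Ω, x ≠ y ∧ |u x - u y| = dist x y} = ⋃ n, L n := by
    rw [hLU]
    ext x
    constructor
    · rintro ⟨hx, y, hy, hne, h⟩
      exact ⟨(x, y), ⟨⟨hx, hy, hne⟩, h⟩, rfl⟩
    · rintro ⟨⟨x', y⟩, ⟨⟨hx, hy, hne⟩, h⟩, rfl⟩
      exact ⟨hx, y, hy, hne, h⟩
  rw [heq]
  exact MeasurableSet.iUnion fun n => (hL n).measurableSet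

/-- **Uniqueness of the Kantorovich maximizer (Euclidean case)**: if `f` vanishes on a
`μ`-null set only, then any two `1`-Lipschitz maximizers of `v ↦ ∫ v f dμ` differ by a
constant on `Ω`. -/
theorem kantorovich_maximizer_unique {n : ℕ} (hn : 2 ≤ n)
    (Ω : Set (EuclideanSpace ℝ (Fin n))) (hne : Ω.Nonempty) (ho : IsOpen Ω)
    (hconv : Convex ℝ Ω)
    (ρ : EuclideanSpace ℝ (Fin n) → ℝ) (hρ : ContDiffOn ℝ (⊤ : ℕ∞) ρ Ω)
    (μ : Measure (EuclideanSpace ℝ (Fin n)))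
    (hμ : μ = (volume.restrict Ω).withDensity fun x => ENNReal.ofReal (Real.exp (-ρ x)))
    (f : EuclideanSpace ℝ (Fin n) → ℝ) (hf : Integrable f μ) (hf0 : ∫ x, f x ∂μ = 0)
    (x₀ : EuclideanSpace ℝ (Fin n)) (hx₀ : x₀ ∈ Ω)
    (hfd : Integrable (fun x => |f x| * ‖x - x₀‖) μ)
    (hzero : μ {x | f x = 0} = 0)
    (u₁ u₂ : EuclideanSpace ℝ (Fin n) → ℝ)
    (hu₁ : LipschitzOnWith 1 u₁ Ω) (hu₂ : LipschitzOnWith 1 u₂ Ω)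
    (hmax₁ : ∀ v : EuclideanSpace ℝ (Fin n) → ℝ, LipschitzOnWith 1 v Ω →
      ∫ x, v x * f x ∂μ ≤ ∫ x, u₁ x * f x ∂μ)
    (hmax₂ : ∀ v : EuclideanSpace ℝ (Fin n) → ℝ, LipschitzOnWith 1 v Ω →
      ∫ x, v x * f x ∂μ ≤ ∫ x, u₂ x * f x ∂μ) :
    ∃ c : ℝ, ∀ x ∈ Ω, u₁ x - u₂ x = c := by
  have hΩm := ho.measurableSet
  have hdm : AEMeasurable (fun x => ENNReal.ofReal (Real.exp (-ρ x))) (volume.restrict Ω) := by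
    have : AEMeasurable ρ (volume.restrict Ω) := hρ.continuousOn.aemeasurable hΩm
    exact (Real.measurable_exp.comp_aemeasurable this.neg).ennreal_ofReal
  have hac1 : μ ≪ volume.restrict Ω := hμ ▸ withDensity_absolutelyContinuous _ _
  have hac2 : volume.restrict Ω ≪ μ := by
    rw [hμ]
    exact withDensity_absolutelyContinuous' hdm
      (Eventually.of_forall fun x => by simp [Real.exp_pos])
  have hac3 : μ ≪ volume := hac1.trans Measure.restrict_le_self.absolutelyContinuous
  have hΩ : ∀ᵐ x ∂μ, x ∈ Ω := hac1.ae_le (ae_restrict_mem hΩm)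
  obtain ⟨w₁, hw₁, he₁⟩ := hu₁.extend_real
  obtain ⟨w₂, hw₂, he₂⟩ := hu₂.extend_real
  have hint : ∀ v : EuclideanSpace ℝ (Fin n) → ℝ, LipschitzWith 1 v →
      Integrable (fun x => v x * f x) μ := fun v hv => by
    refine ((hf.norm.const_mul |v x₀|).add hfd).mono'
      (hv.continuous.aestronglyMeasurable.mul hf.1) (Eventually.of_forall fun x => ?_)
    have h1 : |v x - v x₀| ≤ ‖x - x₀‖ := by
      simpa [Real.dist_eq, dist_eq_norm] using hv.dist_le_mul x x₀
    have h2 : |v x| ≤ |v x₀| + ‖x - x₀‖ := by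
      have := abs_add_le (v x - v x₀) (v x₀)
      rw [sub_add_cancel] at this
      linarith
    simp only [norm_mul, Real.norm_eq_abs, Pi.add_apply]
    nlinarith [abs_nonneg (f x)]
  have hi₁ : ∫ x, u₁ x * f x ∂μ = ∫ x, w₁ x * f x ∂μ :=
    integral_congr_ae (by filter_upwards [hΩ] with x hx; rw [he₁ hx])
  have hi₂ : ∫ x, u₂ x * f x ∂μ = ∫ x, w₂ x * f x ∂μ :=
    integral_congr_ae (by filter_upwards [hΩ] with x hx; rw [he₂ hx])
  rw [hi₁] at hmax₁
  rw [hi₂] at hmax₂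
  set u : EuclideanSpace ℝ (Fin n) → ℝ := fun x => (w₁ x + w₂ x) / 2 with hudef
  have hb₁ : ∀ x y, |w₁ x - w₁ y| ≤ dist x y := fun x y => by
    simpa [Real.dist_eq] using hw₁.dist_le_mul x y
  have hb₂ : ∀ x y, |w₂ x - w₂ y| ≤ dist x y := fun x y => by
    simpa [Real.dist_eq] using hw₂.dist_le_mul x y
  have hu : LipschitzWith 1 u := by
    apply LipschitzWith.of_le_add
    intro x y
    have h1 := (abs_le.1 (hb₁ x y)).2
    have h2 := (abs_le.1 (hb₂ x y)).2
    simp only [hudef]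
    linarith
  have hbu : ∀ x y, |u x - u y| ≤ dist x y := fun x y => by
    simpa [Real.dist_eq] using hu.dist_le_mul x y
  have humax : ∀ v : EuclideanSpace ℝ (Fin n) → ℝ, LipschitzWith 1 v →
      ∫ x, v x * f x ∂μ ≤ ∫ x, u x * f x ∂μ := fun v hv => by
    have h1 := hmax₁ v hv.lipschitzOnWith
    have h2 := hmax₂ v hv.lipschitzOnWith
    have : ∀ x, u x * f x = (1 / 2) * (w₁ x * f x + w₂ x * f x) := fun x => by
      simp only [hudef]; ring
    simp_rw [this]
    rw [integral_const_mul, integral_add (hint _ hw₁) (hint _ hw₂)]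
    linarith
  set T : Set (EuclideanSpace ℝ (Fin n)) :=
    {x | x ∈ Ω ∧ ∃ y ∈ Ω, x ≠ y ∧ |u x - u y| = dist x y} with hT
  have hTm : MeasurableSet T := km_meas Ω ho u hu.continuous
  have hstrict : ∀ K ⊆ Ω \ T, ∀ x ∈ Ω, ∀ y ∈ K, x ≠ y → |u x - u y| < dist x y := by
    intro K hK x hx y hy hne
    refine lt_of_le_of_ne (hbu x y) fun h => (hK hy).2 ⟨(hK hy).1, x, hx, hne.symm, ?_⟩
    rw [abs_sub_comm, dist_comm, h]
  have hneg : ∀ᵐ x ∂μ, x ∈ Ω \ T → -f x ≤ 0 := by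
    refine km_sign μ volume Ω (Ω \ T) (hΩm.diff hTm) diff_subset hΩm hac3 hac2 (fun x => -f x)
      hf.neg fun K hK hKn hKA => ?_
    have := km_key μ Ω hΩ f u hf hu (hint u hu) humax K hK hKn
      fun x hx y hy hne => (abs_lt.1 (hstrict K hKA x hx y hy hne)).2
    rw [integral_neg]
    linarith
  have hpos : ∀ᵐ x ∂μ, x ∈ Ω \ T → f x ≤ 0 := by
    refine km_sign μ volume Ω (Ω \ T) (hΩm.diff hTm) diff_subset hΩm hac3 hac2 f
      hf fun K hK hKn hKA => ?_
    have := km_key μ Ω hΩ (fun x => - f x) (fun x => - u x) hf.neg hu.neg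
      (by simpa using hint u hu)
      (fun v hv => by
        have h := humax (fun x => - v x) hv.neg
        simpa [neg_mul, mul_neg] using h) K hK hKn
      fun x hx y hy hne => by
        have := (abs_lt.1 (hstrict K hKA x hx y hy hne)).1
        linarith
    rw [integral_neg] at this
    linarith
  have hf_ne : ∀ᵐ x ∂μ, f x ≠ 0 := by rw [ae_iff]; simpa using hzero
  have hTae : ∀ᵐ x ∂μ, x ∈ T := by
    filter_upwards [hΩ, hneg, hpos, hf_ne] with x h1 h2 h3 h4
    by_contra hc
    exact h4 (le_antisymm (h3 ⟨h1, hc⟩) (by linarith [h2 ⟨h1, hc⟩]))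
  have hTvol : ∀ᵐ x ∂(volume : Measure (EuclideanSpace ℝ (Fin n))), x ∈ Ω → x ∈ T :=
    (ae_restrict_iff' hΩm).1 (hac2.ae_le hTae)
  have hder : ∀ᵐ x ∂(volume : Measure (EuclideanSpace ℝ (Fin n))), x ∈ Ω →
      HasFDerivAt (fun x => w₁ x - w₂ x) (0 : EuclideanSpace ℝ (Fin n) →L[ℝ] ℝ) x := by
    filter_upwards [hTvol, hw₁.ae_differentiableAt, hw₂.ae_differentiableAt] with x hxT hd₁ hd₂ hx
    obtain ⟨-, y, hy, hne, hxy⟩ := hxT hx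
    have a1 := abs_le.1 (hb₁ x y)
    have a2 := abs_le.1 (hb₂ x y)
    have hgr : gradient w₁ x = gradient w₂ x := by
      simp only [hudef] at hxy
      rcases eq_or_eq_neg_of_abs_eq hxy with h | h
      · rw [km_grad w₁ hw₁ x y hne hd₁ (-1) (Or.inr rfl) (by linarith),
          km_grad w₂ hw₂ x y hne hd₂ (-1) (Or.inr rfl) (by linarith)]
      · rw [km_grad w₁ hw₁ x y hne hd₁ 1 (Or.inl rfl) (by linarith),
          km_grad w₂ hw₂ x y hne hd₂ 1 (Or.inl rfl) (by linarith)]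
    have hfd' : fderiv ℝ w₁ x = fderiv ℝ w₂ x := by
      simpa [gradient] using hgr
    have := hd₁.hasFDerivAt.sub hd₂.hasFDerivAt
    rw [hfd', sub_self] at this
    exact this
  refine ⟨u₁ x₀ - u₂ x₀, fun x hx => ?_⟩
  have := km_const volume Ω ho hconv (fun x => w₁ x - w₂ x) (1 + 1) (hw₁.sub hw₂) hder x x₀ hx hx₀
  rw [he₁ hx, he₂ hx, he₁ hx₀, he₂ hx₀]
  exact this
end
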